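/- Let V be a complex inner product space of even dimension M = 2K ≥ 6 with a fixed orthonormal basis e_1, …, e_M. Let W ⊆ ⋀³V be the complex subspace spanned by all BSOVs e_{ijk} except the K of them with index triples (1,3,6), (1,4,6), and (1, 2i-3, 2i-1) for 3 ≤ i ≤ K. Then W is universal and dim W = M(M-1)(M-5)/6. -/

import Mathlib

open ExteriorAlgebra Finset

noncomputable section

/-- The single-particle Hilbert space: `ℂ^M` with its standard inner product. -/
abbrev V (M : ℕ) : Type := EuclideanSpace ℂ (Fin M)

/-- The fixed orthonormal basis vector `e_n` (1-indexed, `1 ≤ n ≤ M`);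
out-of-range indices give `0`. -/
def stdVec (M n : ℕ) : V M :=
  if h : 1 ≤ n ∧ n ≤ M then EuclideanSpace.single (⟨n - 1, by omega⟩ : Fin M) 1 else 0

/-- The wedge `e_{i 0} ∧ ⋯ ∧ e_{i (N-1)}` in the exterior algebra of `V M`. -/
def wedge (M N : ℕ) (i : Fin N → ℕ) : ExteriorAlgebra ℂ (V M) :=
  ExteriorAlgebra.ιMulti ℂ N fun j => stdVec M (i j)

/-- `i` enumerates a strictly increasing sequence of indices in `{1, …, M}`. -/
def IsBasisIndex (M N : ℕ) (i : Fin N → ℕ) : Prop :=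
  StrictMono i ∧ ∀ j, 1 ≤ i j ∧ i j ≤ M

/-- Single occupancy: no two of the indices lie in the same standard pair
`{2k-1, 2k}` (the pair of `n` is `(n+1)/2`). -/
def SingleOcc (N : ℕ) (i : Fin N → ℕ) : Prop :=
  ∀ j k : Fin N, j ≠ k → (i j + 1) / 2 ≠ (i k + 1) / 2

/-- The single occupancy subspace `𝒮 ⊆ ⋀^N V`: the span of all basic single
occupancy vectors. -/
def SOV (M N : ℕ) : Submodule ℂ (ExteriorAlgebra ℂ (V M)) :=
  Submodule.span ℂ
    {x | ∃ i : Fin N → ℕ, IsBasisIndex M N i ∧ SingleOcc N i ∧ x = wedge M N i}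

/-- The exterior power of a unitary operator `U` on `V M`, acting on the whole
exterior algebra (on `⋀^N V` it acts as `⋀^N U`). -/
def luMap (M : ℕ) (U : V M ≃ₗᵢ[ℂ] V M) :
    ExteriorAlgebra ℂ (V M) →ₐ[ℂ] ExteriorAlgebra ℂ (V M) :=
  ExteriorAlgebra.map U.toLinearEquiv.toLinearMap

section TopForm

variable {κ : Type*} [Fintype κ] [DecidableEq κ]

/-- The top-degree component of the product of the bilinear expressions `ω r`, `r : κ`, on a space
with coordinates indexed by `κ × Bool`. -/
def topForm {R : Type*} [CommRing R] (ω : κ → κ × Bool → κ × Bool → R) : R :=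
  ∑ σ : Equiv.Perm (κ × Bool), ((Equiv.Perm.sign σ : ℤ) : R) *
    ∏ r, ω r (σ (r, false)) (σ (r, true))

theorem sum_sign_mul_eq_zero {α R : Type*} [Fintype α] [DecidableEq α] [CommRing R]
    {p q : α} (hpq : p ≠ q) (G : Equiv.Perm α → R)
    (hG : ∀ σ : Equiv.Perm α, G (σ * Equiv.swap p q) = G σ) :
    ∑ σ : Equiv.Perm α, ((Equiv.Perm.sign σ : ℤ) : R) * G σ = 0 := by
  refine Finset.sum_involution (fun σ _ => σ * Equiv.swap p q) ?_ ?_ ?_ ?_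
  · intro σ _
    simp [hG, Equiv.Perm.sign_mul, Equiv.Perm.sign_swap hpq]
  · intro σ _ _ h
    have := congrArg (fun τ : Equiv.Perm α => σ⁻¹ * τ) h
    simp only [inv_mul_cancel_left, inv_mul_cancel] at this
    exact hpq (Equiv.swap_eq_one_iff.1 this)
  · intro σ _; exact mem_univ _
  · intro σ _; simp [mul_assoc]

theorem topForm_eq_zero_of_symm {R : Type*} [CommRing R] (ω : κ → κ × Bool → κ × Bool → R) (r : κ)
    (h : ∀ a b, ω r a b = ω r b a) : topForm ω = 0 := by
  refine sum_sign_mul_eq_zero (p := (r, false)) (q := (r, true)) (by simp) _ fun σ => ?_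
  refine Finset.prod_congr rfl fun s _ => ?_
  by_cases hs : s = r
  · subst hs; simp [h]
  · rw [Equiv.Perm.mul_apply, Equiv.Perm.mul_apply,
      Equiv.swap_apply_of_ne_of_ne (by simp [hs]) (by simp [hs]),
      Equiv.swap_apply_of_ne_of_ne (by simp [hs]) (by simp [hs])]

variable {R : Type*} [CommRing R] [Algebra ℝ R] (D : κ × Bool → Derivation ℝ R R)

theorem derivation_prod {ι : Type*} [DecidableEq ι] (d : Derivation ℝ R R) (s : Finset ι)
    (f : ι → R) : d (∏ i ∈ s, f i) = ∑ i ∈ s, d (f i) * ∏ j ∈ s.erase i, f j := by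
  induction s using Finset.induction_on with
  | empty => simp
  | insert a s ha ih =>
    rw [prod_insert ha, Derivation.leibniz, sum_insert ha, erase_insert ha, ih, smul_eq_mul,
      smul_eq_mul, mul_comm (∏ i ∈ s, f i), add_comm, mul_sum]
    congr 1
    refine sum_congr rfl fun i hi => ?_
    have hne : a ≠ i := fun h => ha (h ▸ hi)
    rw [erase_insert_of_ne hne, prod_insert (by simp [ha])]
    ring

theorem integral_exact_eq_zero (I : R →ₗ[ℝ] ℝ) (hI : ∀ a f, I (D a f) = 0)
    (ω : κ → κ × Bool → κ × Bool → R)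
    (hω : ∀ r a b c, D a (ω r b c) = D b (ω r a c)) (r : κ) (l : κ × Bool → R) :
    I (∑ σ : Equiv.Perm (κ × Bool), ((Equiv.Perm.sign σ : ℤ) : R) *
      (D (σ (r, false)) (l (σ (r, true))) *
        ∏ s ∈ univ.erase r, ω s (σ (s, false)) (σ (s, true)))) = 0 := by
  have key : ∑ σ : Equiv.Perm (κ × Bool), ((Equiv.Perm.sign σ : ℤ) : R) *
      (D (σ (r, false)) (l (σ (r, true))) *
        ∏ s ∈ univ.erase r, ω s (σ (s, false)) (σ (s, true))) =
      ∑ σ : Equiv.Perm (κ × Bool), (Equiv.Perm.sign σ : ℤ) •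
        D (σ (r, false)) (l (σ (r, true)) *
        ∏ s ∈ univ.erase r, ω s (σ (s, false)) (σ (s, true))) -
      ∑ s ∈ univ.erase r, ∑ σ : Equiv.Perm (κ × Bool), ((Equiv.Perm.sign σ : ℤ) : R) *
        (l (σ (r, true)) * (D (σ (r, false)) (ω s (σ (s, false)) (σ (s, true))) *
          ∏ t ∈ (univ.erase r).erase s, ω t (σ (t, false)) (σ (t, true)))) := by
    rw [sum_comm, ← sum_sub_distrib]
    refine sum_congr rfl fun σ _ => ?_
    rw [Derivation.leibniz, derivation_prod, zsmul_eq_mul, ← mul_sum, ← mul_sum]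
    simp only [smul_eq_mul]
    ring
  rw [key, map_sub, map_sum]
  have h1 : ∀ σ : Equiv.Perm (κ × Bool), I ((Equiv.Perm.sign σ : ℤ) •
        D (σ (r, false)) (l (σ (r, true)) *
        ∏ s ∈ univ.erase r, ω s (σ (s, false)) (σ (s, true)))) = 0 := by
    intro σ
    rw [map_zsmul, hI, smul_zero]
  rw [sum_congr rfl fun σ _ => h1 σ, sum_const_zero, zero_sub, neg_eq_zero]
  rw [sum_eq_zero, map_zero]
  intro s hs
  have hsr : s ≠ r := (mem_erase.1 hs).1
  refine sum_sign_mul_eq_zero (p := (r, false)) (q := (s, false)) (by simp [hsr.symm]) _ fun σ => ?_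
  simp only [Equiv.Perm.mul_apply, Equiv.swap_apply_left, Equiv.swap_apply_right]
  rw [Equiv.swap_apply_of_ne_of_ne (by simp) (by simp),
    Equiv.swap_apply_of_ne_of_ne (by simp) (by simp), hω]
  congr 2
  refine prod_congr rfl fun t ht => ?_
  have h2 := mem_erase.1 ht
  have h3 := mem_erase.1 h2.2
  rw [Equiv.swap_apply_of_ne_of_ne (by simp [h3.1]) (by simp [h2.1]),
    Equiv.swap_apply_of_ne_of_ne (by simp) (by simp)]

theorem integral_topForm_sub_exact (I : R →ₗ[ℝ] ℝ) (hI : ∀ a f, I (D a f) = 0)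
    (hD : ∀ a b f, D a (D b f) = D b (D a f))
    (c : κ → κ × Bool → κ × Bool → ℝ) (l : κ → κ × Bool → R) :
    I (topForm fun r a b => algebraMap ℝ R (c r a b) - D a (l r b)) =
      I (topForm fun r a b => algebraMap ℝ R (c r a b)) := by
  suffices h : ∀ S : Finset κ,
      I (topForm fun r a b => algebraMap ℝ R (c r a b) - if r ∈ S then D a (l r b) else 0) =
      I (topForm fun r a b => algebraMap ℝ R (c r a b)) by
    simpa using h univ
  intro S
  induction S using Finset.induction_on with
  | empty => simp
  | insert r S hr ih =>
    rw [← ih, ← sub_eq_zero, ← map_sub, ← neg_eq_zero, ← map_neg]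
    rw [← integral_exact_eq_zero D I hI
      (fun r a b => algebraMap ℝ R (c r a b) - if r ∈ S then D a (l r b) else 0) ?_ r (l r)]
    · congr 1
      unfold topForm
      rw [← sum_sub_distrib, ← sum_neg_distrib]
      refine sum_congr rfl fun σ _ => ?_
      rw [← mul_prod_erase univ _ (mem_univ r), ← mul_prod_erase univ _ (mem_univ r)]
      rw [prod_congr (g := fun s => algebraMap ℝ R (c s (σ (s, false)) (σ (s, true))) -
        if s ∈ S then D (σ (s, false)) (l s (σ (s, true))) else 0) rfl fun s hs => by
          simp [(mem_erase.1 hs).1]]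
      simp only [mem_insert, true_or, if_true, hr, if_false]
      ring
    · intro s a b c'
      split_ifs
      · rw [map_sub, map_sub, hD a b]; simp
      · simp

end TopForm

section Pairing

variable {κ : Type*}

/-- The permutation of `κ × Bool` permuting blocks by `τ` after flipping the blocks where `ε`
holds. -/
def blockPerm (x : Equiv.Perm κ × (κ → Bool)) : Equiv.Perm (κ × Bool) :=
  (Equiv.prodCongrLeft fun _ => x.1) *
    Equiv.prodCongrRight fun k => if x.2 k then Equiv.swap false true else 1

theorem blockPerm_apply (x : Equiv.Perm κ × (κ → Bool)) (k : κ) (b : Bool) :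
    blockPerm x (k, b) = (x.1 k, xor (x.2 k) b) := by
  unfold blockPerm
  cases h : x.2 k <;> cases b <;> simp [h]

theorem blockPerm_injective : Function.Injective (blockPerm (κ := κ)) := by
  rintro ⟨τ, ε⟩ ⟨τ', ε'⟩ h
  have h' := fun k => congrArg (fun σ : Equiv.Perm (κ × Bool) => σ (k, false)) h
  simp only [blockPerm_apply, Prod.mk.injEq, Bool.xor_false] at h'
  exact Prod.ext (Equiv.ext fun k => (h' k).1) (funext fun k => (h' k).2)

theorem exists_blockPerm_eq [Finite κ] (σ : Equiv.Perm (κ × Bool))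
    (h : ∀ k, (σ (k, false)).1 = (σ (k, true)).1) : ∃ x, blockPerm x = σ := by
  have hflip : ∀ k, (σ (k, true)).2 = !(σ (k, false)).2 := by
    intro k
    have hne : σ (k, true) ≠ σ (k, false) := fun e => by simpa using σ.injective e
    by_contra hc
    exact hne (Prod.ext (h k).symm (by simpa using hc))
  have hinj : Function.Injective fun k => (σ (k, false)).1 := by
    intro k l hkl
    dsimp only at hkl
    by_cases hb : (σ (k, false)).2 = (σ (l, false)).2
    · exact congrArg Prod.fst (σ.injective (Prod.ext hkl hb))
    · have : σ (k, true) = σ (l, false) := by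
        refine Prod.ext (by rw [← h, hkl]) ?_
        rw [hflip]
        revert hb
        cases (σ (k, false)).2 <;> cases (σ (l, false)).2 <;> simp
      simpa using σ.injective this
  refine ⟨(Equiv.ofBijective _ (Finite.injective_iff_bijective.1 hinj),
    fun k => (σ (k, false)).2), Equiv.ext ?_⟩
  rintro ⟨k, b⟩
  rw [blockPerm_apply]
  cases b
  · simp
  · refine Prod.ext (by simp [h]) (by simp [hflip])

variable [Fintype κ] [DecidableEq κ]

theorem sign_blockPerm (x : Equiv.Perm κ × (κ → Bool)) :
    Equiv.Perm.sign (blockPerm x) = ∏ k, if x.2 k then -1 else 1 := by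
  unfold blockPerm
  rw [Equiv.Perm.sign_mul, Equiv.Perm.sign_prodCongrLeft, Equiv.Perm.sign_prodCongrRight]
  simp only [prod_const, card_univ, Fintype.card_bool, Int.units_sq, one_mul]
  refine prod_congr rfl fun k _ => ?_
  split_ifs <;> simp

theorem topForm_eq_of_block {R : Type*} [CommRing R] (c : κ → κ × Bool → κ × Bool → R)
    (hc : ∀ r a b, a.1 ≠ b.1 → c r a b = 0) :
    topForm c = ∑ τ : Equiv.Perm κ,
      ∏ r, (c r (τ r, false) (τ r, true) - c r (τ r, true) (τ r, false)) := by
  have h1 : ∀ τ : Equiv.Perm κ,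
      ∏ r, (c r (τ r, false) (τ r, true) - c r (τ r, true) (τ r, false)) =
      ∑ ε : κ → Bool, ∏ r, (if ε r then -1 else 1) * c r (τ r, ε r) (τ r, !(ε r)) := by
    intro τ
    rw [← Fintype.piFinset_univ,
      ← Finset.prod_univ_sum (fun _ => univ)
      (fun r (e : Bool) => (if e then -1 else 1) * c r (τ r, e) (τ r, !e))]
    refine prod_congr rfl fun r _ => ?_
    simp
    ring
  rw [sum_congr rfl fun τ _ => h1 τ, ← Fintype.sum_prod_type', topForm]
  symm
  refine sum_of_injOn blockPerm blockPerm_injective.injOn (fun _ _ => by simp) ?_ ?_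
  · intro σ _ hσ
    have : ∃ k, (σ (k, false)).1 ≠ (σ (k, true)).1 := by
      by_contra hcon
      push Not at hcon
      obtain ⟨x, hx⟩ := exists_blockPerm_eq σ hcon
      exact hσ ⟨x, by simp, hx⟩
    obtain ⟨k, hk⟩ := this
    rw [prod_eq_zero (mem_univ k) (hc _ _ _ hk), mul_zero]
  · rintro ⟨τ, ε⟩ _
    rw [sign_blockPerm, prod_mul_distrib]
    simp only [blockPerm_apply, Bool.xor_false, Bool.xor_true]
    congr 1
    simp only [Units.coe_prod, Int.cast_prod]
    refine prod_congr rfl fun r _ => ?_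
    split_ifs <;> simp

end Pairing

section Periodic

open MeasureTheory
open scoped ContDiff

variable {α : Type*} [Fintype α] [DecidableEq α]

/-- The partial derivative of `f` in the coordinate direction `a`. -/
def partialDeriv {E : Type*} [NormedAddCommGroup E] [NormedSpace ℝ E] (a : α)
    (f : (α → ℝ) → E) (x : α → ℝ) : E :=
  fderiv ℝ f x (Pi.single a 1)

theorem contDiff_partialDeriv {E : Type*} [NormedAddCommGroup E] [NormedSpace ℝ E] (a : α)
    {f : (α → ℝ) → E} (hf : ContDiff ℝ ∞ f) : ContDiff ℝ ∞ (partialDeriv a f) :=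
  (hf.fderiv_right (m := ∞) (by simp)).clm_apply contDiff_const

theorem partialDeriv_comm {E : Type*} [NormedAddCommGroup E] [NormedSpace ℝ E] (a b : α)
    {f : (α → ℝ) → E} (hf : ContDiff ℝ ∞ f) (x : α → ℝ) :
    partialDeriv a (partialDeriv b f) x = partialDeriv b (partialDeriv a f) x := by
  have hs : IsSymmSndFDerivAt ℝ f x := by
    refine hf.contDiffAt.isSymmSndFDerivAt ?_
    simp [minSmoothness_of_isRCLikeNormedField]
    exact WithTop.coe_le_coe.2 le_top
  have hd : DifferentiableAt ℝ (fderiv ℝ f) x :=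
    ((hf.fderiv_right (m := ∞) (by simp)).differentiable (by simp)).differentiableAt
  unfold partialDeriv
  rw [fderiv_clm_apply hd (differentiableAt_const _),
    fderiv_clm_apply hd (differentiableAt_const _)]
  simpa using hs.eq _ _

/-- Smooth real functions on `α → ℝ` that are periodic in each coordinate with period one. -/
def periodicSmooth (α : Type*) [Fintype α] [DecidableEq α] : Subalgebra ℝ ((α → ℝ) → ℝ) where
  carrier := {f | ContDiff ℝ ∞ f ∧ ∀ a x, f (x + Pi.single a 1) = f x}
  mul_mem' hf hg := ⟨hf.1.mul hg.1, fun a x => by simp [hf.2, hg.2]⟩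
  add_mem' hf hg := ⟨hf.1.add hg.1, fun a x => by simp [hf.2, hg.2]⟩
  algebraMap_mem' r := ⟨contDiff_const, fun a x => rfl⟩

theorem partialDeriv_periodic (a b : α) {f : (α → ℝ) → ℝ}
    (hp : ∀ a x, f (x + Pi.single a 1) = f x) (x : α → ℝ) :
    partialDeriv a f (x + Pi.single b 1) = partialDeriv a f x := by
  unfold partialDeriv
  rw [← fderiv_comp_add_right]
  congr 2
  exact funext fun y => hp b y

/-- Partial differentiation as a derivation of the algebra of smooth periodic functions. -/
def periodicDeriv (a : α) : Derivation ℝ (periodicSmooth α) (periodicSmooth α) :=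
  Derivation.mk'
    { toFun := fun f => ⟨partialDeriv a f.1, contDiff_partialDeriv a f.2.1,
        fun b x => partialDeriv_periodic a b f.2.2 x⟩
      map_add' := fun f g => Subtype.ext <| funext fun x => by
        change fderiv ℝ (f.1 + g.1) x _ = _
        rw [fderiv_add (f.2.1.differentiable (by simp) x) (g.2.1.differentiable (by simp) x)]
        rfl
      map_smul' := fun r f => Subtype.ext <| funext fun x => by
        change fderiv ℝ (r • f.1) x _ = _
        rw [fderiv_const_smul (f.2.1.differentiable (by simp) x)]
        rfl }
    fun f g => Subtype.ext <| funext fun x => by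
      change fderiv ℝ (f.1 * g.1) x _ = _
      rw [fderiv_mul (f.2.1.differentiable (by simp) x) (g.2.1.differentiable (by simp) x)]
      rfl

/-- The integral of a smooth periodic function over the unit cube. -/
def periodicIntegral (α : Type*) [Fintype α] [DecidableEq α] : periodicSmooth α →ₗ[ℝ] ℝ where
  toFun f := ∫ x in Set.Icc (0 : α → ℝ) 1, f.1 x
  map_add' f g := integral_add
    (f.2.1.continuous.continuousOn.integrableOn_compact isCompact_Icc)
    (g.2.1.continuous.continuousOn.integrableOn_compact isCompact_Icc)
  map_smul' r _ := integral_const_mul r _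

theorem periodicIntegral_algebraMap (r : ℝ) :
    periodicIntegral α (algebraMap ℝ (periodicSmooth α) r) = r := by
  change ∫ x in Set.Icc (0 : α → ℝ) 1, r = r
  rw [setIntegral_const, Measure.real, Real.volume_Icc_pi]
  simp

theorem periodicIntegral_deriv (a : α) (f : periodicSmooth α) :
    periodicIntegral α (periodicDeriv a f) = 0 := by
  change ∫ x in Set.Icc (0 : α → ℝ) 1, partialDeriv a f.1 x = 0
  obtain ⟨n, hn⟩ : ∃ n, Fintype.card α = n + 1 :=
    ⟨Fintype.card α - 1, (Nat.succ_pred_eq_of_pos (Fintype.card_pos_iff.2 ⟨a⟩)).symm⟩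
  let e : α ≃ Fin (n + 1) := Fintype.equivFinOfCardEq hn
  let eL : (α → ℝ) ≃L[ℝ] (Fin (n + 1) → ℝ) := ContinuousLinearEquiv.piCongrLeft ℝ (fun _ => ℝ) e
  have heL : ∀ x i, eL x i = x (e.symm i) := fun x i => by
    have := Equiv.piCongrLeft_apply_apply (fun _ : Fin (n + 1) => ℝ) e x (e.symm i)
    rw [Equiv.apply_symm_apply] at this
    exact this
  have heLs : ∀ x i, eL.symm x i = x (e i) := fun x i => rfl
  rw [integral_divergence_of_hasFDerivAt_off_countable_of_equiv eL
    (fun x y => by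
      simp only [Pi.le_def, heL]
      exact ⟨fun h i => by simpa using h (e i), fun h i => h _⟩)
    (volume_measurePreserving_piCongrLeft (fun _ => ℝ) e)
    (fun i => if e a = i then f.1 else 0)
    (fun i => if e a = i then fderiv ℝ f.1 else 0) ∅ Set.countable_empty 0 1 zero_le_one
    ?_ ?_ (fun x => partialDeriv a f.1 x) ?_ ?_]
  · refine sum_eq_zero fun i _ => ?_
    rw [sub_eq_zero]
    refine setIntegral_congr_fun measurableSet_Icc fun x _ => ?_
    split_ifs with hi
    · refine Eq.trans ?_ (f.2.2 a _)
      refine congrArg f.1 (funext fun b => ?_)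
      rw [Pi.add_apply, heLs, heLs]
      subst hi
      by_cases hb : b = a
      · subst hb; simp [heL]
      · have : e b ≠ e a := fun h => hb (e.injective h)
        obtain ⟨j, hj⟩ := Fin.exists_succAbove_eq this
        rw [← hj]
        simp [hb]
    · rfl
  · intro i
    split_ifs
    · exact f.2.1.continuous.continuousOn
    · exact continuousOn_const
  · intro x _ i
    split_ifs
    · exact (f.2.1.differentiable (by simp) x).hasFDerivAt
    · exact hasFDerivAt_const _ _
  · intro x
    rw [sum_eq_single (e a)]
    · simp only [if_true]
      unfold partialDeriv
      congr 1
      ext b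
      rw [heLs]
      simp [Pi.single_apply]
    · intro i _ hi
      simp [hi.symm]
    · simp
  · exact (contDiff_partialDeriv a f.2.1).continuous.continuousOn.integrableOn_compact
      isCompact_Icc

end Periodic

section QuasiPeriodic

open scoped ContDiff ComplexConjugate

/-- There is a smooth function on the line that agrees with the inverse beyond a positive
threshold. -/
theorem exists_smooth_inv (δ : ℝ) (hδ : 0 < δ) :
    ∃ g : ℝ → ℝ, ContDiff ℝ ∞ g ∧ ∀ t, δ ≤ t → g t = t⁻¹ := by
  have hs : ContDiff ℝ ∞ fun t : ℝ => Real.smoothTransition (t / δ) :=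
    Real.smoothTransition.contDiff.comp (contDiff_id.div_const δ)
  refine ⟨fun t => (Real.smoothTransition (t / δ) * t + (1 - Real.smoothTransition (t / δ)))⁻¹,
    ((hs.mul contDiff_id).add (contDiff_const.sub hs)).inv fun t => ?_, fun t ht => ?_⟩
  · rcases le_or_gt t 0 with h | h
    · rw [Real.smoothTransition.zero_of_nonpos (div_nonpos_of_nonpos_of_nonneg h hδ.le)]
      norm_num
    · have h0 := Real.smoothTransition.nonneg (t / δ)
      have h1 := Real.smoothTransition.le_one (t / δ)
      rcases eq_or_lt_of_le h0 with h' | h'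
      · simp [← h']
      · have := mul_pos h' h
        simp only [id]
        linarith
  · dsimp only
    rw [Real.smoothTransition.one_of_one_le ((one_le_div hδ).2 ht)]
    simp

variable {κ : Type*}

/-- The connection form of the standard line bundle with Chern numbers `w`. -/
def flatPotential (w : κ → ℤ) (b : κ × Bool) (x : κ × Bool → ℝ) : ℝ :=
  if b.2 then w b.1 * x (b.1, false) else 0

/-- The curvature coefficients of `flatPotential`. -/
def flatCurvature [DecidableEq κ] (w : κ → ℤ) (a b : κ × Bool) : ℝ :=
  if b.2 ∧ a = (b.1, false) then w b.1 else 0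

theorem contDiff_flatPotential [Fintype κ] (w : κ → ℤ) (b : κ × Bool) :
    ContDiff ℝ ∞ (flatPotential w b) := by
  unfold flatPotential
  split_ifs
  · exact contDiff_const.mul (contDiff_apply ℝ ℝ _)
  · exact contDiff_const

theorem partialDeriv_flatPotential [Fintype κ] [DecidableEq κ] (w : κ → ℤ) (a b : κ × Bool)
    (x : κ × Bool → ℝ) :
    partialDeriv a (flatPotential w b) x = flatCurvature w a b := by
  unfold flatPotential flatCurvature partialDeriv
  obtain ⟨i, e⟩ := b
  cases e
  · simp
  · simp only [if_true, true_and]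
    have h : HasFDerivAt (fun x : κ × Bool → ℝ => (w i : ℝ) * x (i, false))
      ((w i : ℝ) • ContinuousLinearMap.proj (R := ℝ) (φ := fun _ : κ × Bool => ℝ) (i, false)) x :=
      (ContinuousLinearMap.proj (R := ℝ) (φ := fun _ : κ × Bool => ℝ)
        (i, false)).hasFDerivAt.const_mul (w i : ℝ)
    rw [h.fderiv]
    simp [Pi.single_apply, eq_comm]

theorem flatPotential_add_single [DecidableEq κ] (w : κ → ℤ) (b a : κ × Bool) (x : κ × Bool → ℝ) :
    flatPotential w b (x + Pi.single a 1) = flatPotential w b x + flatCurvature w a b := by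
  unfold flatPotential flatCurvature
  obtain ⟨i, e⟩ := b
  cases e
  · simp
  · simp [Pi.single_apply, mul_add, eq_comm]

theorem contDiff_normSq [Fintype κ] {F : (κ × Bool → ℝ) → ℂ} (hF : ContDiff ℝ ∞ F) :
    ContDiff ℝ ∞ fun x => Complex.normSq (F x) := by
  simp only [Complex.normSq_eq_norm_sq]
  exact hF.norm_sq ℂ

variable [Fintype κ] [DecidableEq κ]

/-- The current `Im (conj F ∂_b F)` of a complex function. -/
def current (F : (κ × Bool → ℝ) → ℂ) (b : κ × Bool) (x : κ × Bool → ℝ) : ℝ :=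
  (conj (F x) * partialDeriv b F x).im

theorem contDiff_current {F : (κ × Bool → ℝ) → ℂ} (hF : ContDiff ℝ ∞ F) (b : κ × Bool) :
    ContDiff ℝ ∞ (current F b) :=
  Complex.imCLM.contDiff.comp
    ((Complex.conjCLE.contDiff.comp hF).mul (contDiff_partialDeriv b hF))

theorem current_add_single {F : (κ × Bool → ℝ) → ℂ} (hF : ContDiff ℝ ∞ F) (w : κ → ℤ)
    (h1 : ∀ i x, F (x + Pi.single (i, true) 1) = F x)
    (h2 : ∀ i x, F (x + Pi.single (i, false) 1) =
      Complex.exp (2 * Real.pi * Complex.I * w i * x (i, true)) * F x)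
    (a b : κ × Bool) (x : κ × Bool → ℝ) :
    current F b (x + Pi.single a 1) =
      current F b x + 2 * Real.pi * flatCurvature w a b * Complex.normSq (F x) := by
  have hd := hF.differentiable (by simp) x
  have hsh : partialDeriv b F (x + Pi.single a 1) =
      partialDeriv b (fun y => F (y + Pi.single a 1)) x := by
    unfold partialDeriv
    rw [fderiv_comp_add_right]
  obtain ⟨i, e⟩ := a
  cases e
  · unfold current
    rw [hsh, funext (h2 i), h2]
    set m : (κ × Bool → ℝ) → ℂ :=
      fun y => Complex.exp (2 * Real.pi * Complex.I * w i * y (i, true)) with hm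
    have hp : HasFDerivAt (fun y : κ × Bool → ℝ => ((y (i, true) : ℝ) : ℂ))
        (Complex.ofRealCLM.comp (ContinuousLinearMap.proj (R := ℝ)
          (φ := fun _ : κ × Bool => ℝ) (i, true))) x :=
      (Complex.ofRealCLM.comp (ContinuousLinearMap.proj (R := ℝ)
          (φ := fun _ : κ × Bool => ℝ) (i, true))).hasFDerivAt
    have hm' := (hp.const_mul (2 * Real.pi * Complex.I * w i)).cexp
    have hnorm : conj (m x) * m x = 1 := by
      rw [mul_comm, Complex.mul_conj, Complex.normSq_eq_norm_sq]
      have : m x = Complex.exp (((2 * Real.pi * w i * x (i, true) : ℝ) : ℂ) * Complex.I) := by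
        simp only [hm]; congr 1; push_cast; ring
      rw [this, Complex.norm_exp_ofReal_mul_I]
      simp
    have hD : partialDeriv b (fun y => m y * F y) x =
        m x * (partialDeriv b F x +
          2 * Real.pi * Complex.I * flatCurvature w (i, false) b * F x) := by
      unfold partialDeriv
      rw [fderiv_fun_mul hm'.differentiableAt hd, hm'.fderiv]
      obtain ⟨j, e⟩ := b
      cases e
      · simp [flatCurvature, hm]
      · by_cases hj : i = j
        · subst hj
          simp [flatCurvature]
          simp [hm]
          ring
        · simp [flatCurvature, hj, hm]
    change (conj (m x * F x) * partialDeriv b (fun y => m y * F y) x).im = _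
    rw [hD, map_mul]
    have : conj (m x) * conj (F x) * (m x * (partialDeriv b F x +
          2 * Real.pi * Complex.I * flatCurvature w (i, false) b * F x)) =
        (conj (m x) * m x) * (conj (F x) * partialDeriv b F x +
          ((2 * Real.pi * flatCurvature w (i, false) b : ℝ) : ℂ) * (F x * conj (F x)) *
            Complex.I) := by
      push_cast; ring
    rw [this, hnorm, one_mul, Complex.mul_conj, Complex.add_im, ← Complex.ofReal_mul,
      Complex.im_ofReal_mul]
    simp
  · unfold current
    rw [hsh, funext (h1 i), h1]
    simp [flatCurvature]

theorem partialDeriv_log_symm {F : (κ × Bool → ℝ) → ℂ} (hF : ContDiff ℝ ∞ F)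
    (a b : κ × Bool) (x : κ × Bool → ℝ) (hx : F x ≠ 0) :
    partialDeriv a (fun y => (partialDeriv b F y / F y).im) x =
      partialDeriv b (fun y => (partialDeriv a F y / F y).im) x := by
  have key : ∀ a b, partialDeriv a (fun y => (partialDeriv b F y / F y).im) x =
      ((partialDeriv a (partialDeriv b F) x * F x - partialDeriv b F x * partialDeriv a F x) /
        F x ^ 2).im := by
    intro a b
    have hd := (hF.differentiable (by simp) x).hasFDerivAt
    have hd' := ((contDiff_partialDeriv b hF).differentiable (by simp) x).hasFDerivAt
    have h := Complex.imCLM.hasFDerivAt.comp x (hd'.mul ((hasFDerivAt_inv' hx).comp x hd))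
    unfold partialDeriv at h ⊢
    have h' : HasFDerivAt (fun y => (fderiv ℝ F y (Pi.single b 1) / F y).im) _ x := h
    rw [h'.fderiv]
    simp only [ContinuousLinearMap.comp_apply, Complex.imCLM_apply]
    congr 1
    simp
    field_simp
    ring
  rw [key, key, partialDeriv_comm a b hF, mul_comm (partialDeriv b F x)]

theorem sum_perm_prod_eq_zero (w : κ → κ → ℤ) (F : κ → (κ × Bool → ℝ) → ℂ)
    (hF : ∀ r, ContDiff ℝ ∞ (F r))
    (h1 : ∀ r i x, F r (x + Pi.single (i, true) 1) = F r x)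
    (h2 : ∀ r i x, F r (x + Pi.single (i, false) 1) =
      Complex.exp (2 * Real.pi * Complex.I * w r i * x (i, true)) * F r x)
    (h0 : ∀ x, ∃ r, F r x ≠ 0) :
    ∑ τ : Equiv.Perm κ, ∏ r, w r (τ r) = 0 := by
  have hu : ∀ r a x, Complex.normSq (F r (x + Pi.single a 1)) = Complex.normSq (F r x) := by
    rintro r ⟨i, e⟩ x
    cases e
    · rw [h2, Complex.normSq_mul, Complex.normSq_eq_norm_sq (Complex.exp _)]
      have : 2 * Real.pi * Complex.I * w r i * x (i, true) =
          ((2 * Real.pi * w r i * x (i, true) : ℝ) : ℂ) * Complex.I := by push_cast; ring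
      rw [this, Complex.norm_exp_ofReal_mul_I]
      simp
    · rw [h1]
  set S : (κ × Bool → ℝ) → ℝ := fun x => ∑ r, Complex.normSq (F r x) with hS
  have hSpos : ∀ x, 0 < S x := fun x => by
    obtain ⟨r, hr⟩ := h0 x
    exact sum_pos' (fun _ _ => Complex.normSq_nonneg _) ⟨r, mem_univ _, Complex.normSq_pos.2 hr⟩
  have hScont : ContDiff ℝ ∞ S := ContDiff.sum fun r _ => contDiff_normSq (hF r)
  have hSper : ∀ a x, S (x + Pi.single a 1) = S x := fun a x => by simp only [hS, hu]
  have hδ : (0 : ℝ) < 1 / (Fintype.card κ + 1) := by positivity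
  obtain ⟨g, hg, hginv⟩ := exists_smooth_inv _ hδ
  let l : κ → κ × Bool → periodicSmooth (κ × Bool) := fun r b =>
    ⟨fun x => g (Complex.normSq (F r x) / S x) *
      (Complex.normSq (F r x) / S x * flatPotential (w r) b x -
        current (F r) b x / (2 * Real.pi * S x)), by
      have ht : ContDiff ℝ ∞ fun x => Complex.normSq (F r x) / S x :=
        (contDiff_normSq (hF r)).div hScont fun x => (hSpos x).ne'
      refine ⟨(hg.comp ht).mul ((ht.mul (contDiff_flatPotential _ _)).sub
        ((contDiff_current (hF r) b).div (contDiff_const.mul hScont) fun x =>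
          (mul_pos Real.two_pi_pos (hSpos x)).ne')), fun a x => ?_⟩
      dsimp only
      rw [hu, hSper, flatPotential_add_single,
        current_add_single (hF r) (w r) (h1 r) (h2 r)]
      have := (hSpos x).ne'
      have := Real.pi_ne_zero
      congr 1
      field_simp
      ring⟩
  have hzero : topForm (fun r a b => algebraMap ℝ (periodicSmooth (κ × Bool))
      (flatCurvature (w r) a b) - periodicDeriv a (l r b)) = 0 := by
    refine Subtype.ext (funext fun x => ?_)
    have hev : (topForm (fun r a b => algebraMap ℝ (periodicSmooth (κ × Bool))
        (flatCurvature (w r) a b) - periodicDeriv a (l r b))).1 x =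
        topForm (fun r a b => flatCurvature (w r) a b - partialDeriv a (l r b).1 x) := by
      have := map_sum ((Pi.evalRingHom (fun _ : κ × Bool → ℝ => ℝ) x).comp
        (periodicSmooth (κ × Bool)).val.toRingHom)
        (fun σ : Equiv.Perm (κ × Bool) => ((Equiv.Perm.sign σ : ℤ) : periodicSmooth (κ × Bool)) *
          ∏ r, (algebraMap ℝ (periodicSmooth (κ × Bool))
            (flatCurvature (w r) (σ (r, false)) (σ (r, true))) -
            periodicDeriv (σ (r, false)) (l r (σ (r, true))))) univ
      simp only [map_mul, map_prod, map_sub, map_intCast] at this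
      exact this
    rw [hev]
    change _ = (0 : ℝ)
    obtain ⟨r, hr⟩ : ∃ r, 1 / ((Fintype.card κ : ℝ) + 1) < Complex.normSq (F r x) / S x := by
      by_contra hcon
      push Not at hcon
      have h3 : ∑ r, Complex.normSq (F r x) / S x = 1 := by
        rw [← sum_div]; exact div_self (hSpos x).ne'
      have h4 := sum_le_sum fun r (_ : r ∈ univ) => hcon r
      rw [h3, sum_const, card_univ, nsmul_eq_mul, mul_one_div, one_le_div (by positivity)] at h4
      linarith
    refine topForm_eq_zero_of_symm _ r fun a b => ?_
    have hne : F r x ≠ 0 := fun h => by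
      rw [h] at hr; simp at hr; linarith [inv_pos.1 (one_div_pos.1 hδ |> inv_pos.2)]
    have hloc : ∀ b, (l r b).1 =ᶠ[nhds x] fun y => flatPotential (w r) b y -
        (2 * Real.pi)⁻¹ * (partialDeriv b (F r) y / F r y).im := by
      intro b
      have hopen : ∀ᶠ y in nhds x,
          1 / ((Fintype.card κ : ℝ) + 1) < Complex.normSq (F r y) / S y :=
        (((contDiff_normSq (hF r)).continuous.div hScont.continuous
          fun x => (hSpos x).ne').tendsto x).eventually_const_lt hr
      filter_upwards [hopen] with y hy
      change g _ * _ = _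
      rw [hginv _ hy.le]
      have hq : 0 < Complex.normSq (F r y) / S y := hδ.trans hy
      have hSy := hSpos y
      have hn : Complex.normSq (F r y) ≠ 0 := fun h => by simp [h] at hq
      have hcur : (partialDeriv b (F r) y / F r y).im =
          current (F r) b y / Complex.normSq (F r y) := by
        unfold current
        rw [div_eq_mul_inv, Complex.inv_def, ← mul_assoc, Complex.im_mul_ofReal,
          div_eq_mul_inv, mul_comm (partialDeriv b (F r) y)]
      rw [hcur]
      have := Real.pi_ne_zero
      field_simp
    have hder : ∀ a b, flatCurvature (w r) a b - partialDeriv a (l r b).1 x =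
        (2 * Real.pi)⁻¹ * partialDeriv a (fun y => (partialDeriv b (F r) y / F r y).im) x := by
      intro a b
      have hA := ((contDiff_flatPotential (w r) b).differentiable (by simp) x)
      have hB : DifferentiableAt ℝ (fun y => (partialDeriv b (F r) y / F r y).im) x :=
        Complex.imCLM.differentiableAt.comp x
          (((contDiff_partialDeriv b (hF r)).differentiable (by simp) x).mul
            (((hF r).differentiable (by simp) x).inv hne))
      rw [← partialDeriv_flatPotential (w r) a b x]
      unfold partialDeriv at hB ⊢
      rw [(hloc b).fderiv_eq]
      unfold partialDeriv
      rw [fderiv_fun_sub hA (hB.const_mul _), fderiv_const_mul hB]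
      simp
    rw [hder, hder, partialDeriv_log_symm (hF r) a b x hne]
  have hintegral := integral_topForm_sub_exact periodicDeriv (periodicIntegral (κ × Bool))
    periodicIntegral_deriv
    (fun a b f => Subtype.ext (funext fun x => partialDeriv_comm a b f.2.1 x))
    (fun r => flatCurvature (w r)) l
  rw [hzero, map_zero] at hintegral
  have hmap : topForm (fun r a b => algebraMap ℝ (periodicSmooth (κ × Bool))
      (flatCurvature (w r) a b)) = algebraMap ℝ _ (topForm fun r => flatCurvature (w r)) := by
    unfold topForm
    simp only [map_sum, map_mul, map_prod, map_intCast]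
  rw [hmap, periodicIntegral_algebraMap, topForm_eq_of_block] at hintegral
  · simp only [flatCurvature] at hintegral
    simp at hintegral
    exact_mod_cast hintegral.symm
  · rintro r a b hab
    unfold flatCurvature
    rw [if_neg]
    rintro ⟨_, rfl⟩
    exact hab rfl

end QuasiPeriodic

section Theta

open scoped ContDiff

/-- A smooth bump that is positive exactly on the open unit interval. -/
def unitBump (t : ℝ) : ℝ := expNegInvGlue t * expNegInvGlue (1 - t)

theorem contDiff_unitBump : ContDiff ℝ ∞ unitBump :=
  expNegInvGlue.contDiff.mul (expNegInvGlue.contDiff.comp (contDiff_const.sub contDiff_id))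

theorem unitBump_of_nonpos {t : ℝ} (h : t ≤ 0) : unitBump t = 0 := by
  rw [unitBump, expNegInvGlue.zero_of_nonpos h, zero_mul]

theorem unitBump_of_one_le {t : ℝ} (h : 1 ≤ t) : unitBump t = 0 := by
  rw [unitBump, expNegInvGlue.zero_of_nonpos (x := 1 - t) (by linarith), mul_zero]

theorem unitBump_pos {t : ℝ} (h0 : 0 < t) (h1 : t < 1) : 0 < unitBump t :=
  mul_pos (expNegInvGlue.pos_of_pos h0) (expNegInvGlue.pos_of_pos (by linarith))

/-- A smooth section of the degree one line bundle on the two-dimensional torus, vanishing exactly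
where `y` is an integer. -/
def thetaSection (x y : ℝ) : ℂ :=
  unitBump (Int.fract y) * Complex.exp (2 * Real.pi * Complex.I * ⌊y⌋ * x)

theorem contDiff_thetaSection : ContDiff ℝ ∞ fun p : ℝ × ℝ => thetaSection p.1 p.2 := by
  have hterm : ∀ m : ℤ, ContDiff ℝ ∞ fun p : ℝ × ℝ =>
      (unitBump (p.2 - m) : ℂ) * Complex.exp (2 * Real.pi * Complex.I * m * p.1) := fun m =>
    (Complex.ofRealCLM.contDiff.comp (contDiff_unitBump.comp
      (contDiff_snd.sub contDiff_const))).mul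
      (contDiff_const.mul (Complex.ofRealCLM.contDiff.comp contDiff_fst)).cexp
  rw [contDiff_iff_contDiffAt]
  rintro ⟨x, y⟩
  refine ((hterm (⌊y⌋ - 1)).add (hterm ⌊y⌋)).contDiffAt.congr_of_eventuallyEq ?_
  have hopen : ∀ᶠ p : ℝ × ℝ in nhds (x, y), p.2 ∈ Set.Ioo ((⌊y⌋ : ℝ) - 1) (⌊y⌋ + 1) :=
    continuous_snd.continuousAt.eventually_mem (Ioo_mem_nhds
      (by linarith [Int.floor_le y]) (Int.lt_floor_add_one y))
  filter_upwards [hopen] with p hp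
  unfold thetaSection Int.fract
  rcases lt_or_ge p.2 ⌊y⌋ with h | h
  · have hfl : ⌊p.2⌋ = ⌊y⌋ - 1 := by
      rw [Int.floor_eq_iff]; push_cast; exact ⟨hp.1.le, by linarith⟩
    rw [hfl, unitBump_of_nonpos (t := p.2 - ⌊y⌋) (by linarith)]
    simp
  · have hfl : ⌊p.2⌋ = ⌊y⌋ := by
      rw [Int.floor_eq_iff]; exact ⟨h, hp.2⟩
    rw [hfl, unitBump_of_one_le (t := p.2 - (⌊y⌋ - 1 : ℤ)) (by push_cast; linarith)]
    simp

theorem thetaSection_add_one_left (x y : ℝ) : thetaSection (x + 1) y = thetaSection x y := by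
  unfold thetaSection
  congr 1
  rw [Complex.exp_eq_exp_iff_exists_int]
  exact ⟨⌊y⌋, by push_cast; ring⟩

theorem thetaSection_add_one_right (x y : ℝ) :
    thetaSection x (y + 1) = Complex.exp (2 * Real.pi * Complex.I * x) * thetaSection x y := by
  unfold thetaSection
  rw [Int.fract_add_one, Int.floor_add_one, mul_left_comm, ← Complex.exp_add]
  congr 2
  push_cast
  ring

theorem fract_eq_zero_of_thetaSection {x y : ℝ} (h : thetaSection x y = 0) : Int.fract y = 0 := by
  by_contra hne
  have := unitBump_pos (lt_of_le_of_ne (Int.fract_nonneg y) (Ne.symm hne)) (Int.fract_lt_one y)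
  simp [thetaSection, this.ne'] at h

theorem thetaSection_ne_zero (x y : ℝ) (h : thetaSection x y = 0) :
    thetaSection x (y + 1 / 2) ≠ 0 := by
  intro h'
  have h1 := fract_eq_zero_of_thetaSection h
  have h2 := fract_eq_zero_of_thetaSection h'
  rw [Int.fract_eq_zero_iff] at h1 h2
  obtain ⟨m, hm⟩ := h1
  obtain ⟨n, hn⟩ := h2
  have : (2 * n - 2 * m : ℝ) = 1 := by rw [hm, hn]; ring
  have h3 : 2 * n - 2 * m = 1 := by exact_mod_cast this
  omega

variable {I : Type*} {n : ℕ}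

/-- The binary form of degree `n` whose roots are the images of `n` points of the torus under a
degree one map to the projective line. -/
def thetaForm (i : I) (X : (I × Fin n) × Bool → ℝ) : Polynomial ℂ :=
  ∏ j : Fin n, (Polynomial.C (thetaSection (X ((i, j), true)) (X ((i, j), false))) +
    Polynomial.C (thetaSection (X ((i, j), true)) (X ((i, j), false) + 1 / 2)) * Polynomial.X)

/-- The vector of coefficients of `thetaForm`. -/
def thetaVec (X : (I × Fin n) × Bool → ℝ) (i : I) (c : Fin (n + 1)) : ℂ := (thetaForm i X).coeff c

theorem thetaVec_ne_zero (X : (I × Fin n) × Bool → ℝ) (i : I) : thetaVec X i ≠ 0 := by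
  have hne : thetaForm i X ≠ 0 := by
    refine prod_ne_zero_iff.2 fun j _ h => ?_
    have h0 := congrArg (fun p => Polynomial.coeff p 0) h
    have h1 := congrArg (fun p => Polynomial.coeff p 1) h
    simp [Polynomial.coeff_C] at h0 h1
    exact thetaSection_ne_zero _ _ h0 (by simpa using h1)
  have hdeg : (thetaForm i X).natDegree ≤ n := by
    refine (Polynomial.natDegree_prod_le _ _).trans ?_
    refine (sum_le_card_nsmul _ _ 1 fun j _ => ?_).trans (by simp)
    compute_degree
  intro h
  have := congrFun h ⟨(thetaForm i X).natDegree, Nat.lt_succ_of_le hdeg⟩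
  exact hne (Polynomial.leadingCoeff_eq_zero.1 this)

theorem contDiff_thetaVec [Fintype I] :
    ContDiff ℝ ∞ (thetaVec : ((I × Fin n) × Bool → ℝ) → I → Fin (n + 1) → ℂ) := by
  have hsec : ∀ (k : I × Fin n) (a : ℝ), ContDiff ℝ ∞ fun X : (I × Fin n) × Bool → ℝ =>
      thetaSection (X (k, true)) (X (k, false) + a) := fun k a =>
    contDiff_thetaSection.comp ((contDiff_apply ℝ ℝ (k, true)).prodMk
      ((contDiff_apply ℝ ℝ (k, false)).add contDiff_const))
  have key : ∀ (i : I) (s : Finset (Fin n)) (c : ℕ),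
      ContDiff ℝ ∞ fun X : (I × Fin n) × Bool → ℝ =>
      (∏ j ∈ s, (Polynomial.C (thetaSection (X ((i, j), true)) (X ((i, j), false))) +
        Polynomial.C (thetaSection (X ((i, j), true)) (X ((i, j), false) + 1 / 2)) *
          Polynomial.X)).coeff c := by
    intro i s
    induction s using Finset.induction_on with
    | empty => intro c; simp only [prod_empty]; exact contDiff_const
    | insert a s ha ih =>
      intro c
      simp only [prod_insert ha, add_mul, mul_assoc, Polynomial.coeff_add, Polynomial.coeff_C_mul]
      have h0 := hsec (i, a) 0
      simp only [add_zero] at h0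
      refine (h0.mul (ih c)).add ((hsec (i, a) _).mul ?_)
      cases c with
      | zero => simp only [Polynomial.coeff_X_mul_zero]; exact contDiff_const
      | succ c => simp only [Polynomial.coeff_X_mul]; exact ih c
  exact contDiff_pi.2 fun i => contDiff_pi.2 fun c => key i univ c

variable [DecidableEq I]

theorem thetaVec_add_single_true (X : (I × Fin n) × Bool → ℝ) (k : I × Fin n) :
    thetaVec (X + Pi.single (k, true) 1) = thetaVec X := by
  funext i c
  unfold thetaVec thetaForm
  congr 1
  refine prod_congr rfl fun j _ => ?_
  by_cases h : (i, j) = k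
  · simp [h, thetaSection_add_one_left]
  · simp [h]

theorem thetaVec_add_single_false (X : (I × Fin n) × Bool → ℝ) (k : I × Fin n) :
    thetaVec (X + Pi.single (k, false) 1) = Function.update (thetaVec X) k.1
      (Complex.exp (2 * Real.pi * Complex.I * X (k, true)) • thetaVec X k.1) := by
  obtain ⟨i', j'⟩ := k
  funext i c
  by_cases hi : i = i'
  · subst hi
    rw [Function.update_self, Pi.smul_apply, smul_eq_mul]
    unfold thetaVec thetaForm
    rw [← Polynomial.coeff_C_mul, ← mul_prod_erase univ _ (mem_univ j'),
      ← mul_prod_erase univ _ (mem_univ j'), ← mul_assoc]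
    congr 2
    · simp only [Pi.add_apply, Pi.single_eq_same]
      rw [add_right_comm, thetaSection_add_one_right, thetaSection_add_one_right]
      simp
      ring
    · refine prod_congr rfl fun j hj => ?_
      have : j ≠ j' := (mem_erase.1 hj).1
      simp [this]
  · rw [Function.update_of_ne hi]
    unfold thetaVec thetaForm
    congr 1
    refine prod_congr rfl fun j _ => ?_
    simp [hi]

end Theta

section CommonZero

open scoped ContDiff

variable {I ι : Type*} [Fintype I] [DecidableEq I] [Fintype ι] [DecidableEq ι] {n : ℕ}

theorem coeff_prod_linear (ν : ι → I → ℤ) :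
    (∏ r, ∑ i, MvPolynomial.C (ν r i) * MvPolynomial.X i : MvPolynomial I ℤ).coeff
      (Finsupp.equivFunOnFinite.symm fun _ => n) =
    ∑ h : ι → I, if ∀ i, #{r | h r = i} = n then ∏ r, ν r (h r) else 0 := by
  rw [prod_univ_sum, Fintype.piFinset_univ, MvPolynomial.coeff_sum]
  refine sum_congr rfl fun h _ => ?_
  have hmon : (∏ r, MvPolynomial.C (ν r (h r)) * MvPolynomial.X (h r) : MvPolynomial I ℤ) =
      MvPolynomial.monomial (∑ r, Finsupp.single (h r) 1) (∏ r, ν r (h r)) := by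
    rw [MvPolynomial.monomial_sum_prod]
    exact prod_congr rfl fun r _ => MvPolynomial.C_mul_X_eq_monomial
  rw [hmon, MvPolynomial.coeff_monomial]
  refine if_congr ?_ rfl rfl
  rw [Finsupp.ext_iff]
  refine forall_congr' fun i => ?_
  rw [Finsupp.finsetSum_apply, card_filter]
  simp [Finsupp.single_apply]

theorem exists_perm_of_balanced (h : I × Fin n → I) (hb : ∀ i, #{r | h r = i} = n) :
    ∃ τ : Equiv.Perm (I × Fin n), ∀ r, (τ r).1 = h r := by
  have e : ∀ i, {r // h r = i} ≃ Fin n := fun i =>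
    Fintype.equivFinOfCardEq (by rw [Fintype.card_subtype, hb])
  refine ⟨(Equiv.sigmaFiberEquiv h).symm.trans
    ((Equiv.sigmaCongrRight e).trans (Equiv.sigmaEquivProd I (Fin n))), fun r => rfl⟩

theorem balanced_of_perm (τ : Equiv.Perm (I × Fin n)) (i : I) : #{r | (τ r).1 = i} = n := by
  have : #{r | (τ r).1 = i} = #({i} ×ˢ (univ : Finset (Fin n))) := by
    refine card_bij (fun r _ => τ r) (fun r hr => ?_) (fun _ _ _ _ h => τ.injective h)
      fun b hb => ⟨τ.symm b, ?_, by simp⟩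
    · exact mem_product.2 ⟨mem_singleton.2 (mem_filter.1 hr).2, mem_univ _⟩
    · exact mem_filter.2 ⟨mem_univ _, by simpa using mem_singleton.1 (mem_product.1 hb).1⟩
  rw [this]
  simp

theorem sum_perm_eq_mul_sum_balanced (v : I × Fin n → I → ℤ) :
    ∑ τ : Equiv.Perm (I × Fin n), ∏ r, v r (τ r).1 =
      (#{τ : Equiv.Perm (I × Fin n) | ∀ r, (τ r).1 = r.1} : ℤ) *
      ∑ h : I × Fin n → I, if ∀ i, #{r | h r = i} = n then ∏ r, v r (h r) else 0 := by
  rw [← sum_fiberwise univ (fun τ : Equiv.Perm (I × Fin n) => fun r => (τ r).1), mul_sum]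
  refine sum_congr rfl fun h _ => ?_
  rw [sum_congr rfl (g := fun _ => ∏ r, v r (h r)) fun τ hτ => by
    rw [← (mem_filter.1 hτ).2], sum_const, nsmul_eq_mul]
  split_ifs with hb
  · congr 2
    obtain ⟨τ₀, hτ₀⟩ := exists_perm_of_balanced h hb
    refine card_bij (fun τ _ => τ * τ₀⁻¹) (fun τ hτ => ?_) (fun _ _ _ _ h => mul_right_cancel h)
      fun π hπ => ⟨π * τ₀, ?_, by simp⟩
    · have h1 := (mem_filter.1 hτ).2
      rw [mem_filter]
      refine ⟨mem_univ _, fun r => ?_⟩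
      rw [Equiv.Perm.mul_apply]
      refine (congrFun h1 _).trans ?_
      rw [← hτ₀]
      simp
    · rw [mem_filter] at hπ ⊢
      refine ⟨mem_univ _, funext fun r => ?_⟩
      rw [Equiv.Perm.mul_apply, hπ.2, hτ₀]
  · rw [mul_zero, filter_false_of_mem, card_empty, Nat.cast_zero, zero_mul]
    rintro τ _ rfl
    exact hb (balanced_of_perm τ)

/-- Equivariant smooth equations on tuples of vectors have a common zero consisting of nonzero
vectors as soon as the Bézout-type number given by their weights does not vanish. -/
theorem exists_common_zero (hcard : Fintype.card ι = Fintype.card I * n)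
    (ν : ι → I → ℤ) (Φ : ι → (I → Fin (n + 1) → ℂ) → ℂ)
    (hsm : ∀ r, ContDiff ℝ ∞ (Φ r))
    (heq : ∀ r f i (z : ℂ), ‖z‖ = 1 → Φ r (Function.update f i (z • f i)) = z ^ ν r i * Φ r f)
    (hL : (∏ r, ∑ i, MvPolynomial.C (ν r i) * MvPolynomial.X i : MvPolynomial I ℤ).coeff
      (Finsupp.equivFunOnFinite.symm fun _ => n) ≠ 0) :
    ∃ f : I → Fin (n + 1) → ℂ, (∀ i, f i ≠ 0) ∧ ∀ r, Φ r f = 0 := by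
  by_contra hcon
  have hcon' : ∀ X : (I × Fin n) × Bool → ℝ, ∃ r, Φ r (thetaVec X) ≠ 0 := by
    intro X
    by_contra h
    push Not at h
    exact hcon ⟨thetaVec X, thetaVec_ne_zero X, h⟩
  obtain ⟨e⟩ : Nonempty (ι ≃ I × Fin n) := by
    rw [← Fintype.card_eq]; simp [hcard]
  have h0 := sum_perm_prod_eq_zero (κ := I × Fin n) (fun r k => ν (e.symm r) k.1)
    (fun r X => Φ (e.symm r) (thetaVec X)) (fun r => (hsm _).comp contDiff_thetaVec)
    (fun r k X => by rw [thetaVec_add_single_true])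
    (fun r k X => by
      rw [thetaVec_add_single_false, heq, ← Complex.exp_int_mul]
      · congr 2
        ring
      · have : 2 * Real.pi * Complex.I * X (k, true) =
          ((2 * Real.pi * X (k, true) : ℝ) : ℂ) * Complex.I := by push_cast; ring
        rw [this, Complex.norm_exp_ofReal_mul_I])
    (fun X => by
      obtain ⟨r, hr⟩ := hcon' X
      exact ⟨e r, by simpa using hr⟩)
  rw [sum_perm_eq_mul_sum_balanced (fun r i => ν (e.symm r) i), mul_eq_zero] at h0
  rcases h0 with h0 | h0
  · rw [Nat.cast_eq_zero, card_eq_zero] at h0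
    have : (1 : Equiv.Perm (I × Fin n)) ∈
      ({τ : Equiv.Perm (I × Fin n) | ∀ r, (τ r).1 = r.1} : Finset _) := by simp
    rw [h0] at this
    simp at this
  · refine hL ?_
    rw [← h0, coeff_prod_linear]
    refine Fintype.sum_equiv (e.arrowCongr (Equiv.refl I)) _ _ fun h => ?_
    refine if_congr (forall_congr' fun i => ?_) ?_ rfl
    · rw [card_bij (fun r _ => e r) (t := ({r | e.arrowCongr (Equiv.refl I) h r = i} : Finset _))]
      · intro r hr; simpa using hr
      · intro _ _ _ _ h; exact e.injective h
      · intro b hb; exact ⟨e.symm b, by simpa using hb, by simp⟩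
    · refine Fintype.prod_equiv e _ _ fun r => ?_
      simp

end CommonZero

section Binomial

theorem choose_le_choose_of_le_add (m : ℕ) :
    ∀ p q : ℕ, p ≤ q → m ≤ p + q → m.choose q ≤ m.choose p := by
  induction m with
  | zero =>
    intro p q hpq _
    rcases Nat.eq_zero_or_pos q with rfl | hq
    · rw [Nat.le_zero.1 hpq]
    rcases Nat.eq_zero_or_pos p with rfl | hp
    · simp [Nat.choose_eq_zero_of_lt hq]
    · simp [Nat.choose_eq_zero_of_lt (hp.trans_le hpq)]
  | succ m ih =>
    intro p q hpq hm
    rcases p with _ | p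
    · rcases eq_or_lt_of_le hm with h | h
      · rw [zero_add] at h
        simp [← h]
      · simp [Nat.choose_eq_zero_of_lt (show m + 1 < q by omega)]
    · obtain ⟨q, rfl⟩ : ∃ q', q = q' + 1 := ⟨q - 1, by omega⟩
      rw [Nat.choose_succ_succ', Nat.choose_succ_succ']
      have h1 := ih p (q + 1) (by omega) (by omega)
      rcases eq_or_lt_of_le hpq with h | h
      · rw [Nat.succ.inj h]
      · have h2 := ih (p + 1) q (by omega) (by omega)
        omega

theorem choose_lt_choose_of_lt_add (m : ℕ) :
    ∀ p q : ℕ, p < q → m < p + q → p ≤ m → m.choose q < m.choose p := by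
  induction m with
  | zero =>
    intro p q hpq _ hp
    obtain rfl : p = 0 := by omega
    simp [Nat.choose_eq_zero_of_lt hpq]
  | succ m ih =>
    intro p q hpq hm hp
    rcases p with _ | p
    · simp [Nat.choose_eq_zero_of_lt (show m + 1 < q by omega)]
    · obtain ⟨q, rfl⟩ : ∃ q', q = q' + 1 := ⟨q - 1, by omega⟩
      rw [Nat.choose_succ_succ', Nat.choose_succ_succ']
      have h1 := ih p (q + 1) (by omega) (by omega) (by omega)
      have h2 := choose_le_choose_of_le_add m (p + 1) q (by omega) (by omega)
      omega

theorem alternating_sum_choose_succ (J b : ℕ) :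
    ∑ i ∈ range (2 * J + 1), (-1 : ℤ) ^ i * (i.choose (b + 1) : ℤ) =
      ∑ j ∈ range J, ((2 * j + 1).choose b : ℤ) := by
  induction J with
  | zero => simp
  | succ J ih =>
    rw [show 2 * (J + 1) + 1 = 2 * J + 1 + 1 + 1 by ring, sum_range_succ, sum_range_succ, ih,
      sum_range_succ, Nat.choose_succ_succ (2 * J + 1) b]
    push_cast
    rw [show (-1 : ℤ) ^ (2 * J + 1) = -1 from Odd.neg_one_pow ⟨J, rfl⟩,
      show (-1 : ℤ) ^ (2 * J + 1 + 1) = 1 from Even.neg_one_pow ⟨J + 1, by ring⟩]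
    ring

theorem alternating_sum_choose_ne (K b : ℕ) (hK : 3 ≤ K) (hb : b < K) :
    ∑ i ∈ range (2 * K), (-1 : ℤ) ^ i * (i.choose b : ℤ) ≠
      ∑ i ∈ range (2 * K), (-1 : ℤ) ^ i * (i.choose (2 * K - 1 - b) : ℤ) := by
  obtain ⟨J, rfl⟩ : ∃ J, K = J + 1 := ⟨K - 1, by omega⟩
  rw [show 2 * (J + 1) = 2 * J + 1 + 1 by ring, sum_range_succ, sum_range_succ (n := 2 * J + 1)]
  have hs : (2 * J + 1).choose (2 * J + 1 + 1 - 1 - b) = (2 * J + 1).choose b := by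
    rw [show 2 * J + 1 + 1 - 1 - b = 2 * J + 1 - b by omega]
    exact Nat.choose_symm (by omega)
  rw [hs, Ne, add_left_inj]
  rw [show 2 * J + 1 + 1 - 1 - b = 2 * J - b + 1 by omega, alternating_sum_choose_succ]
  rcases b with _ | b
  · rw [sum_eq_zero (s := range J) fun j hj => by
      rw [Nat.choose_eq_zero_of_lt (by have := mem_range.1 hj; omega), Nat.cast_zero]]
    simp only [Nat.choose_zero_right, Nat.cast_one, mul_one]
    rw [show (∑ i ∈ range (2 * J + 1), (-1 : ℤ) ^ i) = 1 by
      rw [neg_one_geom_sum, if_neg]; simp]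
    exact one_ne_zero
  · rw [alternating_sum_choose_succ]
    refine (sum_lt_sum (fun j hj => ?_) ⟨J - 2, mem_range.2 (by omega), ?_⟩).ne'
    · have := mem_range.1 hj
      exact_mod_cast choose_le_choose_of_le_add _ _ _ (by omega) (by omega)
    · exact_mod_cast choose_lt_choose_of_lt_add _ _ _ (by omega) (by omega) (by omega)

end Binomial

section Vandermonde

open Polynomial

variable {B : Type*} [CommRing B] {M : ℕ}

theorem det_vandermonde_mul_prod_add (v : Fin M → B) (hv : ∀ i, v i ^ M = 0) (z : B) :
    (Matrix.vandermonde v).det * ∏ j, (z + v j) = (Matrix.vandermonde v).det * z ^ M := by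
  have h1 : (Matrix.vandermonde (Fin.cons (-z) v : Fin (M + 1) → B)).det =
      (Matrix.vandermonde v).det * ∏ j, (z + v j) := by
    rw [Matrix.det_vandermonde, Fin.prod_univ_succ, Matrix.det_vandermonde, mul_comm]
    congr 1
    · refine prod_congr rfl fun i _ => ?_
      rw [Fin.Ioi_succ, prod_map]
      simp
    · rw [Fin.Ioi_zero_eq_map, prod_map]
      simp [add_comm]
  rw [← h1, Matrix.det_succ_column _ (Fin.last M), sum_eq_single 0]
  · have : (Matrix.vandermonde (Fin.cons (-z) v : Fin (M + 1) → B)).submatrix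
        (Fin.succAbove 0) (Fin.succAbove (Fin.last M)) = Matrix.vandermonde v := by
      ext i j
      rw [Matrix.submatrix_apply, Matrix.vandermonde_apply, Matrix.vandermonde_apply]
      simp
    rw [this]
    simp only [Matrix.vandermonde_apply, Fin.cons_zero, Fin.val_last, Fin.val_zero, zero_add]
    rw [← mul_pow, neg_mul_neg, one_mul, mul_comm]
  · intro i _ hi
    obtain ⟨j, rfl⟩ := Fin.exists_succ_eq.2 hi
    simp [Matrix.vandermonde_apply, hv]
  · simp

/-- The polynomial which replaces `(x - y) ∏ (x + y + v j)` modulo the annihilator of the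
Vandermonde determinant. -/
def pairQuotient (M : ℕ) (x y : B) : B :=
  ∑ i ∈ range M, (x + y) ^ i * ((-y) ^ (M - 1 - i) - (-x) ^ (M - 1 - i))

theorem det_vandermonde_mul_pair (v : Fin M → B) (hv : ∀ i, v i ^ M = 0) (p q : Fin M)
    (hpq : p ≠ q) :
    (Matrix.vandermonde v).det *
      ((v p - v q) * ∏ j ∈ (univ.erase p).erase q, (v p + v q + v j)) =
      (Matrix.vandermonde v).det * pairQuotient M (v p) (v q) := by
  set W := (Matrix.vandermonde v).det with hW
  have hdet : (Matrix.vandermonde fun i => C (v i)).det = C W := by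
    rw [hW, Matrix.det_vandermonde, Matrix.det_vandermonde]
    simp only [map_prod, map_sub]
  have h1 := det_vandermonde_mul_prod_add (fun i => C (v i))
    (fun i => by rw [← map_pow, hv, map_zero]) (X : B[X])
  rw [hdet, ← mul_prod_erase univ _ (mem_univ p),
    ← mul_prod_erase _ _ (mem_erase.2 ⟨hpq.symm, mem_univ q⟩)] at h1
  have hU : ∀ i, (∑ k ∈ range M, (X : B[X]) ^ k * (-C (v i)) ^ (M - 1 - k)) * (X + C (v i)) =
      X ^ M := by
    intro i
    have := (Commute.all (X : B[X]) (-C (v i))).geom_sum₂_mul M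
    rw [sub_neg_eq_add, neg_pow (C (v i)) M, ← map_pow, hv] at this
    simpa using this
  have hreg : IsRegular ((X + C (v p)) * (X + C (v q)) : B[X]) :=
    ((monic_X_add_C _).mul (monic_X_add_C _)).isRegular
  have key : C W * ((C (v p) - C (v q)) * ∏ j ∈ (univ.erase p).erase q, (X + C (v j))) =
      C W * (∑ k ∈ range M, (X : B[X]) ^ k * (-C (v q)) ^ (M - 1 - k) -
        ∑ k ∈ range M, (X : B[X]) ^ k * (-C (v p)) ^ (M - 1 - k)) := by
    refine hreg.right ?_
    dsimp only
    linear_combination (C (v p) - C (v q)) * h1 - C W * (X + C (v p)) * hU q +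
      C W * (X + C (v q)) * hU p
  have := congrArg (Polynomial.eval (v p + v q)) key
  simp only [eval_mul, eval_C, eval_sub, eval_prod, eval_add, eval_X, eval_finsetSum, eval_pow,
    eval_neg] at this
  rw [this, pairQuotient, ← sum_sub_distrib]
  simp only [mul_sub]

/-- The coefficient of `x ^ a * y ^ b` in `pairQuotient`. -/
def pairCoeff (M a b : ℕ) : ℤ :=
  if a + b + 1 = M then
    ∑ i ∈ range M, (-1) ^ (M - 1 - i) * ((i.choose a : ℤ) - i.choose b) else 0

theorem pairQuotient_eq_sum (x y : B) :
    pairQuotient M x y = ∑ p : Fin M × Fin M, (pairCoeff M p.1 p.2 : B) * (x ^ (p.1 : ℕ) * y ^ (p.2 : ℕ)) := by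
  rcases M with _ | n
  · simp [pairQuotient]
  have h1 : ∑ p : Fin (n + 1) × Fin (n + 1),
      (pairCoeff (n + 1) p.1 p.2 : B) * (x ^ (p.1 : ℕ) * y ^ (p.2 : ℕ)) =
      ∑ a ∈ range (n + 1), (pairCoeff (n + 1) a (n - a) : B) * (x ^ a * y ^ (n - a)) := by
    rw [Fintype.sum_prod_type, ← Fin.sum_univ_eq_sum_range
      (fun a => (pairCoeff (n + 1) a (n - a) : B) * (x ^ a * y ^ (n - a)))]
    refine sum_congr rfl fun a _ => ?_
    rw [sum_eq_single (Fin.rev a)]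
    · simp [Fin.val_rev]
    · intro b _ hb
      rw [pairCoeff, if_neg, Int.cast_zero, zero_mul]
      intro h
      exact hb (Fin.ext (by rw [Fin.val_rev]; dsimp only at h; omega))
    · simp
  have h2 : ∀ i ∈ range (n + 1), (x + y) ^ i * (-y) ^ (n - i) =
      ∑ a ∈ range (n + 1), (-1) ^ (n - i) * (i.choose a : B) * (x ^ a * y ^ (n - a)) := by
    intro i hi
    have hi' := mem_range.1 hi
    rw [add_pow, sum_mul, ← sum_subset (range_subset_range.2 (show i + 1 ≤ n + 1 by omega))]
    · refine sum_congr rfl fun a ha => ?_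
      have := mem_range.1 ha
      rw [neg_pow, show n - a = (i - a) + (n - i) by omega, pow_add]
      ring
    · intro a _ ha
      rw [Nat.choose_eq_zero_of_lt (by simpa using ha)]
      simp
  have h3 : ∀ i ∈ range (n + 1), (x + y) ^ i * (-x) ^ (n - i) =
      ∑ a ∈ range (n + 1), (-1) ^ (n - i) * (i.choose (n - a) : B) * (x ^ a * y ^ (n - a)) := by
    intro i hi
    have hi' := mem_range.1 hi
    rw [← sum_range_reflect, add_comm x y, add_pow, sum_mul,
      ← sum_subset (range_subset_range.2 (show i + 1 ≤ n + 1 by omega))]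
    · refine sum_congr rfl fun a ha => ?_
      have := mem_range.1 ha
      rw [neg_pow, show n + 1 - 1 - a = (i - a) + (n - i) by omega, pow_add,
        show n - ((i - a) + (n - i)) = a by omega]
      ring
    · intro a ha1 ha
      have := mem_range.1 ha1
      rw [show n - (n + 1 - 1 - a) = a by omega,
        Nat.choose_eq_zero_of_lt (by simpa using ha)]
      simp
  rw [h1, pairQuotient]
  simp only [add_tsub_cancel_right, mul_sub]
  rw [sum_sub_distrib, sum_congr rfl h2, sum_congr rfl h3]
  simp only [← sum_sub_distrib]
  rw [sum_comm]
  refine sum_congr rfl fun a ha => ?_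
  have := mem_range.1 ha
  rw [pairCoeff, if_pos (by omega)]
  push_cast
  rw [sum_mul]
  refine sum_congr rfl fun i _ => ?_
  ring

theorem pairCoeff_antisymm (a b : ℕ) : pairCoeff M b a = -pairCoeff M a b := by
  unfold pairCoeff
  rw [show b + a + 1 = a + b + 1 by ring]
  split_ifs
  · rw [← sum_neg_distrib]
    exact sum_congr rfl fun i _ => by ring
  · simp

theorem pairCoeff_ne_zero (K b : ℕ) (hK : 3 ≤ K) (hb : b < K) :
    pairCoeff (2 * K) (2 * K - 1 - b) b ≠ 0 := by
  rw [pairCoeff, if_pos (by omega)]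
  have h : ∀ i ∈ range (2 * K), (-1 : ℤ) ^ (2 * K - 1 - i) *
      ((i.choose (2 * K - 1 - b) : ℤ) - i.choose b) =
      (-1) ^ i * (i.choose b : ℤ) - (-1) ^ i * (i.choose (2 * K - 1 - b) : ℤ) := by
    intro i hi
    have := mem_range.1 hi
    have h1 : (-1 : ℤ) ^ (2 * K - 1 - i) * (-1) ^ i = -1 := by
      rw [← pow_add, Odd.neg_one_pow ⟨K - 1, by omega⟩]
    have h2 : (-1 : ℤ) ^ i * (-1) ^ i = 1 := by
      rw [← mul_pow]; simp
    have h3 : (-1 : ℤ) ^ (2 * K - 1 - i) = -(-1) ^ i := by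
      linear_combination (-1 : ℤ) ^ i * h1 - (-1 : ℤ) ^ (2 * K - 1 - i) * h2
    rw [h3]
    ring
  rw [sum_congr rfl h, sum_sub_distrib, sub_ne_zero]
  exact alternating_sum_choose_ne K b hK hb

end Vandermonde

section Coefficient

open MvPolynomial

/-- The enumeration of `Fin K × Bool` in which the members of a pair add up to `2 * K - 1`. -/
def pairEnum (K : ℕ) : Fin K × Bool ≃ Fin (2 * K) where
  toFun x := if x.2 then ⟨2 * K - 1 - x.1, by omega⟩ else ⟨x.1, by omega⟩
  invFun i := if h : i.1 < K then (⟨i, h⟩, false) else (⟨2 * K - 1 - i, by omega⟩, true)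
  left_inv := by
    rintro ⟨⟨k, hk⟩, b⟩
    cases b
    · simp [hk]
    · have h1 : ¬ 2 * K - 1 - k < K := by omega
      have h2 : 2 * K - 1 - (2 * K - 1 - k) = k := by omega
      simp [h1, h2]
  right_inv := by
    rintro ⟨i, hi⟩
    by_cases h : i < K
    · simp [h]
    · have h2 : 2 * K - 1 - (2 * K - 1 - i) = i := by omega
      simp [h, h2]

theorem pairEnum_false (K : ℕ) (k : Fin K) : (pairEnum K (k, false) : ℕ) = k := rfl

theorem pairEnum_true (K : ℕ) (k : Fin K) : (pairEnum K (k, true) : ℕ) = 2 * K - 1 - k := rfl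

theorem pairEnum_add_ne {K : ℕ} {a b : Fin K × Bool} (h : a.1 ≠ b.1) :
    (pairEnum K a : ℕ) + pairEnum K b ≠ 2 * K - 1 := by
  obtain ⟨k, s⟩ := a
  obtain ⟨l, t⟩ := b
  have hkl : (k : ℕ) ≠ l := fun e => h (Fin.ext e)
  have := k.2
  have := l.2
  cases s <;> cases t <;> simp only [pairEnum_false, pairEnum_true] <;> omega

variable {κ : Type*} [Fintype κ]

theorem prod_X_pow_eq_monomial (d : κ × Bool → ℕ) :
    (∏ i, X i ^ d i : MvPolynomial (κ × Bool) ℤ) =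
      monomial (Finsupp.equivFunOnFinite.symm d) 1 := by
  rw [monomial_eq, C_1, one_mul, Finsupp.prod_fintype _ _ fun _ => pow_zero _]
  rfl

theorem coeff_prod_pow_mul_prod_sum [DecidableEq κ] (M n : ℕ) (hM : n < M) (c : ℕ → ℕ → ℤ) (d : κ × Bool → ℕ)
    (hd : ∀ i, d i ≤ n) :
    ((∏ i, X i ^ d i) * ∏ k : κ, ∑ p : Fin M × Fin M,
      ((c p.1 p.2 : ℤ) : MvPolynomial (κ × Bool) ℤ) *
        (X (k, false) ^ (p.1 : ℕ) * X (k, true) ^ (p.2 : ℕ))).coeff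
      (Finsupp.equivFunOnFinite.symm fun _ => n) =
    ∏ k, c (n - d (k, false)) (n - d (k, true)) := by
  rw [prod_univ_sum, Fintype.piFinset_univ, mul_sum, coeff_sum]
  have hterm : ∀ h : κ → Fin M × Fin M, ((∏ i, X i ^ d i) * ∏ k : κ,
      ((c (h k).1 (h k).2 : ℤ) : MvPolynomial (κ × Bool) ℤ) *
        (X (k, false) ^ ((h k).1 : ℕ) * X (k, true) ^ ((h k).2 : ℕ))) =
      monomial (Finsupp.equivFunOnFinite.symm fun i : κ × Bool =>
        d i + if i.2 then ((h i.1).2 : ℕ) else (h i.1).1) (∏ k, c (h k).1 (h k).2) := by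
    intro h
    have h1 := prod_X_pow_eq_monomial fun i : κ × Bool =>
        d i + if i.2 then ((h i.1).2 : ℕ) else (h i.1).1
    rw [← mul_one (∏ k, c (h k).1 (h k).2), ← C_mul_monomial, ← h1, prod_mul_distrib]
    simp only [pow_add, prod_mul_distrib, map_prod]
    rw [Fintype.prod_prod_type (f := fun i : κ × Bool =>
      (X i : MvPolynomial (κ × Bool) ℤ) ^ (if i.2 then ((h i.1).2 : ℕ) else (h i.1).1))]
    simp only [Fintype.prod_bool, prod_mul_distrib]
    simp
    ring
  rw [sum_eq_single fun k =>
    ((⟨n - d (k, false), by omega⟩, ⟨n - d (k, true), by omega⟩) : Fin M × Fin M)]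
  · rw [hterm, coeff_monomial, if_pos]
    refine congrArg _ (funext ?_)
    rintro ⟨k, b⟩
    have := hd (k, b)
    cases b <;> simp <;> omega
  · intro h _ hne
    rw [hterm, coeff_monomial, if_neg]
    intro heq
    have heq' := congrFun (Finsupp.equivFunOnFinite.symm.injective heq)
    refine hne (funext fun k => Prod.ext (Fin.ext ?_) (Fin.ext ?_))
    · have := heq' (k, false)
      simp at this
      simp only
      omega
    · have := heq' (k, true)
      simp at this
      simp only
      omega
  · simp

theorem coeff_eq_of_quotient_eq {I : Type*} [Fintype I] {n : ℕ} {p q : MvPolynomial I ℤ}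
    (h : Ideal.Quotient.mk (Ideal.span (Set.range fun i : I => (X i : MvPolynomial I ℤ) ^ (n + 1))) p
      = Ideal.Quotient.mk _ q) :
    p.coeff (Finsupp.equivFunOnFinite.symm fun _ => n) =
      q.coeff (Finsupp.equivFunOnFinite.symm fun _ => n) := by
  rw [Ideal.Quotient.eq, Ideal.mem_span_range_iff_exists_fun] at h
  obtain ⟨c, hc⟩ := h
  rw [← sub_eq_zero, ← coeff_sub, ← hc, coeff_sum]
  refine sum_eq_zero fun i _ => ?_
  rw [X_pow_eq_monomial, coeff_mul_monomial', if_neg]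
  intro hle
  have := hle i
  simp at this

theorem mul_prod_congr {ι B : Type*} [CommRing B] (W : B) (s : Finset ι) (a b : ι → B)
    (h : ∀ k, W * a k = W * b k) : W * ∏ k ∈ s, a k = W * ∏ k ∈ s, b k := by
  classical
  induction s using Finset.induction_on with
  | empty => rfl
  | insert k s hk ih =>
    rw [prod_insert hk, prod_insert hk]
    linear_combination (∏ j ∈ s, a j) * h k + b k * ih

theorem coeff_vandermonde_mul_pairs_ne_zero (K : ℕ) (hK : 3 ≤ K) :
    ((Matrix.vandermonde fun i => (X ((pairEnum K).symm i) :
      MvPolynomial (Fin K × Bool) ℤ)).det *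
      ∏ k : Fin K, ((X (k, false) - X (k, true)) *
        ∏ j : {j : Fin K × Bool // j.1 ≠ k}, (X (k, false) + X (k, true) + X j.1))).coeff
      (Finsupp.equivFunOnFinite.symm fun _ => 2 * K - 1) ≠ 0 := by
  set W := (Matrix.vandermonde fun i => (X ((pairEnum K).symm i) :
      MvPolynomial (Fin K × Bool) ℤ)).det with hW
  have hquot : ∀ k : Fin K,
      Ideal.Quotient.mk (Ideal.span (Set.range fun i : Fin K × Bool =>
        (X i : MvPolynomial (Fin K × Bool) ℤ) ^ (2 * K - 1 + 1))) W *
      Ideal.Quotient.mk _ ((X (k, false) - X (k, true)) *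
        ∏ j : {j : Fin K × Bool // j.1 ≠ k}, (X (k, false) + X (k, true) + X j.1)) =
      Ideal.Quotient.mk _ W *
        Ideal.Quotient.mk _ (pairQuotient (2 * K) (X (k, false)) (X (k, true))) := by
    intro k
    set φ := Ideal.Quotient.mk (Ideal.span (Set.range fun i : Fin K × Bool =>
        (X i : MvPolynomial (Fin K × Bool) ℤ) ^ (2 * K - 1 + 1)))
    have h1 := det_vandermonde_mul_pair (fun i => φ (X ((pairEnum K).symm i))) (fun i => by
      rw [← map_pow, Ideal.Quotient.eq_zero_iff_mem]
      refine Ideal.subset_span ⟨(pairEnum K).symm i, ?_⟩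
      dsimp only
      congr 1
      omega) (pairEnum K (k, false)) (pairEnum K (k, true)) (by simp)
    have h2 : (Matrix.vandermonde fun i => φ (X ((pairEnum K).symm i))).det = φ W := by
      rw [hW, Matrix.det_vandermonde, Matrix.det_vandermonde]
      simp only [map_prod, map_sub]
    have h3 : ∀ g : Fin K × Bool → (MvPolynomial (Fin K × Bool) ℤ ⧸ (Ideal.span (Set.range
        fun i : Fin K × Bool => (X i : MvPolynomial (Fin K × Bool) ℤ) ^ (2 * K - 1 + 1)))),
        ∏ j ∈ (univ.erase (pairEnum K (k, false))).erase (pairEnum K (k, true)),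
          g ((pairEnum K).symm j) = ∏ j : {j : Fin K × Bool // j.1 ≠ k}, g j.1 := by
      intro g
      symm
      refine prod_bij (fun j _ => pairEnum K j.1) ?_ ?_ ?_ ?_
      · rintro ⟨j, hj⟩ _
        simp only [mem_erase, mem_univ, and_true, ne_eq, EmbeddingLike.apply_eq_iff_eq]
        exact ⟨fun h => hj (by rw [h]), fun h => hj (by rw [h])⟩
      · intro a _ b _ h
        exact Subtype.ext ((pairEnum K).injective h)
      · intro b hb
        simp only [mem_erase, mem_univ, and_true] at hb
        refine ⟨⟨(pairEnum K).symm b, fun h => ?_⟩, mem_univ _, by simp⟩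
        rcases hc : (pairEnum K).symm b with ⟨l, s⟩
        rw [hc] at h
        simp only at h
        subst h
        rw [Equiv.symm_apply_eq] at hc
        cases s
        · exact hb.2 hc
        · exact hb.1 hc
      · intro a _; simp
    rw [h2] at h1
    simp only [Equiv.symm_apply_apply] at h1
    rw [h3 (fun j => φ (X (k, false)) + φ (X (k, true)) + φ (X j))] at h1
    rw [map_mul, map_sub, map_prod]
    simp only [map_add]
    rw [h1]
    congr 1
    unfold pairQuotient
    simp only [map_sum, map_mul, map_pow, map_add, map_sub, map_neg]
  have hcoeff : (W * ∏ k : Fin K, ((X (k, false) - X (k, true)) *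
        ∏ j : {j : Fin K × Bool // j.1 ≠ k}, (X (k, false) + X (k, true) + X j.1))).coeff
      (Finsupp.equivFunOnFinite.symm fun _ => 2 * K - 1) =
      (W * ∏ k : Fin K, pairQuotient (2 * K) (X (k, false)) (X (k, true))).coeff
      (Finsupp.equivFunOnFinite.symm fun _ => 2 * K - 1) := by
    refine coeff_eq_of_quotient_eq ?_
    rw [map_mul, map_mul, map_prod, map_prod]
    exact mul_prod_congr _ _ _ _ hquot
  have hWsum : W = ∑ σ : Equiv.Perm (Fin K × Bool), ((Equiv.Perm.sign σ : ℤ) :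
      MvPolynomial (Fin K × Bool) ℤ) * ∏ i, X i ^ (pairEnum K (σ i) : ℕ) := by
    rw [hW, ← Matrix.det_submatrix_equiv_self (pairEnum K), ← Matrix.det_transpose,
      Matrix.det_apply']
    refine sum_congr rfl fun σ _ => ?_
    congr 1
    refine prod_congr rfl fun i _ => ?_
    simp [Matrix.vandermonde_apply]
  have hL : (W * ∏ k : Fin K, pairQuotient (2 * K) (X (k, false)) (X (k, true))).coeff
      (Finsupp.equivFunOnFinite.symm fun _ => 2 * K - 1) =
      topForm fun (_ : Fin K) a b => pairCoeff (2 * K) (2 * K - 1 - pairEnum K a)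
        (2 * K - 1 - pairEnum K b) := by
    rw [hWsum, sum_mul, coeff_sum, topForm]
    refine sum_congr rfl fun σ _ => ?_
    simp only [pairQuotient_eq_sum]
    rw [mul_assoc, ← map_intCast (C : ℤ →+* MvPolynomial (Fin K × Bool) ℤ), coeff_C_mul,
      coeff_prod_pow_mul_prod_sum (2 * K) (2 * K - 1) (by omega) (pairCoeff (2 * K))
      (fun i => (pairEnum K (σ i) : ℕ)) (fun i => by omega)]
  rw [hcoeff, hL, topForm_eq_of_block]
  · rw [sum_congr rfl (g := fun _ => ∏ k : Fin K, -2 * pairCoeff (2 * K) (2 * K - 1 - k) k * -1)]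
    · rw [sum_const, nsmul_eq_mul]
      refine mul_ne_zero (by simp [card_univ, Fintype.card_perm, Nat.factorial_ne_zero])
        (prod_ne_zero_iff.2 fun k _ => ?_)
      have := pairCoeff_ne_zero K k hK k.2
      simpa using this
    · intro τ _
      rw [← Equiv.prod_comp τ (fun k => -2 * pairCoeff (2 * K) (2 * K - 1 - k) k * -1)]
      refine prod_congr rfl fun k _ => ?_
      rw [pairEnum_false, pairEnum_true,
        show 2 * K - 1 - (2 * K - 1 - (τ k : ℕ)) = τ k by omega,
        pairCoeff_antisymm (2 * K - 1 - (τ k : ℕ)) (τ k)]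
      ring
  · intro _ a b hab
    have := pairEnum_add_ne hab
    rw [pairCoeff, if_neg]
    have h1 := (pairEnum K a).2
    have h2 := (pairEnum K b).2
    omega

end Coefficient

section AlternatingThree

variable {E : Type*} [AddCommGroup E] [Module ℂ E] (Ψ : E [⋀^Fin 3]→ₗ[ℂ] ℂ)

theorem alternating_three_fst (a b : ℂ) (u u' v w : E) :
    Ψ ![a • u + b • u', v, w] = a * Ψ ![u, v, w] + b * Ψ ![u', v, w] := by
  have h : ∀ x : E, ![x, v, w] = Function.update ![u, v, w] 0 x := fun x => by
    ext i; fin_cases i <;> rfl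
  rw [h, h u', Ψ.map_update_add, Ψ.map_update_smul, Ψ.map_update_smul, ← h, ← h]
  rfl

theorem alternating_three_rotate (u v w : E) : Ψ ![u, v, w] = Ψ ![v, w, u] := by
  have := Ψ.map_perm ![v, w, u] (finRotate 3).symm
  have h : ![v, w, u] ∘ (finRotate 3).symm = ![u, v, w] := by
    ext i; fin_cases i <;> rfl
  rw [h] at this
  rw [this, Equiv.Perm.sign_symm, sign_finRotate]
  simp

theorem alternating_three_snd (a b : ℂ) (u v v' w : E) :
    Ψ ![u, a • v + b • v', w] = a * Ψ ![u, v, w] + b * Ψ ![u, v', w] := by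
  simp only [alternating_three_rotate Ψ u, alternating_three_fst]

theorem alternating_three_thd (a b : ℂ) (u v w w' : E) :
    Ψ ![u, v, a • w + b • w'] = a * Ψ ![u, v, w] + b * Ψ ![u, v, w'] := by
  simp only [alternating_three_rotate Ψ u v, alternating_three_snd]

theorem alternating_three_self_left (u v : E) : Ψ ![u, u, v] = 0 :=
  Ψ.map_eq_zero_of_eq _ (i := 0) (j := 1) rfl (by decide)

theorem alternating_three_self_outer (u v : E) : Ψ ![u, v, u] = 0 :=
  Ψ.map_eq_zero_of_eq _ (i := 0) (j := 2) rfl (by decide)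

theorem alternating_three_self_right (u v : E) : Ψ ![v, u, u] = 0 :=
  Ψ.map_eq_zero_of_eq _ (i := 1) (j := 2) rfl (by decide)

theorem alternating_three_swap (u v w : E) : Ψ ![v, u, w] = -Ψ ![u, v, w] := by
  have := Ψ.map_swap ![u, v, w] (i := 0) (j := 1) (by decide)
  rw [← this]
  congr 1
  ext i; fin_cases i <;> rfl

end AlternatingThree

section PairBasis

open scoped ContDiff ComplexConjugate

theorem alternating_three_eq_sum {m : ℕ} (Ψ : V m [⋀^Fin 3]→ₗ[ℂ] ℂ) (x : Fin 3 → Fin m → ℂ) :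
    Ψ (fun t => WithLp.toLp 2 (x t)) = ∑ s : Fin 3 → Fin m,
      (∏ t, x t (s t)) * Ψ fun t => EuclideanSpace.single (s t) 1 := by
  have h : (fun t => WithLp.toLp 2 (x t)) =
      fun t => ∑ c, x t c • (EuclideanSpace.single c 1 : V m) := by
    ext t c
    simp [Pi.single_apply]
  rw [h]
  have h2 := Ψ.toMultilinearMap.map_sum
    (g := fun t c => x t c • (EuclideanSpace.single c 1 : V m))
  simp only [MultilinearMap.map_smul_univ] at h2
  exact h2

theorem contDiff_alternating_three {m : ℕ} {X : Type*} [NormedAddCommGroup X] [NormedSpace ℝ X]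
    (Ψ : V m [⋀^Fin 3]→ₗ[ℂ] ℂ) (x : Fin 3 → X → Fin m → ℂ) (hx : ∀ t, ContDiff ℝ ∞ (x t)) :
    ContDiff ℝ ∞ fun f => Ψ fun t => WithLp.toLp 2 (x t f) := by
  rw [funext fun f => alternating_three_eq_sum Ψ fun t => x t f]
  refine ContDiff.sum fun s _ => ContDiff.mul (contDiff_prod fun t _ => ?_) contDiff_const
  exact contDiff_pi.1 (hx t) (s t)

theorem sum_C_single_mul_X {I : Type*} [Fintype I] [DecidableEq I] (a : I) :
    ∑ i, MvPolynomial.C ((Pi.single a 1 : I → ℤ) i) * MvPolynomial.X i =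
      (MvPolynomial.X a : MvPolynomial I ℤ) := by
  rw [Finset.sum_eq_single a]
  · simp
  · intro b _ hb
    simp [hb]
  · simp

/-- The equations for a pair-adapted orthogonal family: orthogonality, vanishing on the pairs,
and one vacuous equation for every pair. -/
abbrev PairEq (K : ℕ) : Type :=
  (Σ i : Fin (2 * K), {j // j ∈ Ioi i}) ⊕ (Σ k : Fin K, Option {j : Fin K × Bool // j.1 ≠ k})

def pairWeight (K : ℕ) : PairEq K → Fin K × Bool → ℤ
  | .inl ⟨i, j⟩ => Pi.single ((pairEnum K).symm j) 1 - Pi.single ((pairEnum K).symm i) 1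
  | .inr ⟨k, none⟩ => Pi.single (k, false) 1 - Pi.single (k, true) 1
  | .inr ⟨k, some j⟩ => Pi.single (k, false) 1 + Pi.single (k, true) 1 + Pi.single j.1 1

def pairFun {K m : ℕ} (Ψ : V m [⋀^Fin 3]→ₗ[ℂ] ℂ) :
    PairEq K → (Fin K × Bool → Fin m → ℂ) → ℂ
  | .inl ⟨i, j⟩ => fun f => ∑ c, conj (f ((pairEnum K).symm i) c) * f ((pairEnum K).symm j) c
  | .inr ⟨_, none⟩ => fun _ => 0
  | .inr ⟨k, some j⟩ => fun f =>
      Ψ fun t => WithLp.toLp 2 (f (![(k, false), (k, true), j.1] t))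

theorem card_pairEq (K : ℕ) : Fintype.card (PairEq K) = 2 * K * (2 * K - 1) := by
  have h1 : ∀ k : Fin K, Fintype.card (Option {j : Fin K × Bool // j.1 ≠ k}) = 2 * K - 1 := by
    intro k
    have h : Fintype.card {j : Fin K × Bool // j.1 ≠ k} = 2 * (K - 1) := by
      rw [Fintype.card_congr (β := {j : Fin K // j ≠ k} × Bool)
        { toFun := fun j => (⟨j.1.1, j.2⟩, j.1.2)
          invFun := fun j => ⟨(j.1.1, j.2), j.1.2⟩
          left_inv := fun _ => rfl
          right_inv := fun _ => rfl }]
      simp [Fintype.card_subtype_compl, mul_comm]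
    rw [Fintype.card_option, h]
    have := k.2
    omega
  have h2 : ∑ i : Fin (2 * K), (2 * K - 1 - (i : ℕ)) = K * (2 * K - 1) := by
    rw [Fin.sum_univ_eq_sum_range (fun i => 2 * K - 1 - i), Finset.sum_range_reflect (fun i => i),
      Finset.sum_range_id, mul_assoc, Nat.mul_div_cancel_left _ (by norm_num)]
  rw [Fintype.card_sum, Fintype.card_sigma, Fintype.card_sigma]
  simp only [h1, Fintype.card_coe, Fin.card_Ioi, h2]
  simp
  ring

theorem prod_pairWeight (K : ℕ) :
    (∏ r : PairEq K, ∑ i, MvPolynomial.C (pairWeight K r i) * MvPolynomial.X i :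
      MvPolynomial (Fin K × Bool) ℤ) =
    (Matrix.vandermonde fun i =>
      (MvPolynomial.X ((pairEnum K).symm i) : MvPolynomial (Fin K × Bool) ℤ)).det *
      ∏ k : Fin K, ((MvPolynomial.X (k, false) - MvPolynomial.X (k, true)) *
        ∏ j : {j : Fin K × Bool // j.1 ≠ k},
          (MvPolynomial.X (k, false) + MvPolynomial.X (k, true) + MvPolynomial.X j.1)) := by
  rw [Fintype.prod_sum_type, Fintype.prod_sigma, Fintype.prod_sigma, Matrix.det_vandermonde]
  congr 1
  · refine prod_congr rfl fun i _ => ?_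
    rw [← Finset.prod_coe_sort (Ioi i)]
    refine prod_congr rfl fun j _ => ?_
    simp only [pairWeight, Pi.sub_apply, map_sub, sub_mul, sum_sub_distrib, sum_C_single_mul_X]
  · refine prod_congr rfl fun k _ => ?_
    rw [Fintype.prod_option]
    simp only [pairWeight, Pi.sub_apply, map_sub, sub_mul, sum_sub_distrib, sum_C_single_mul_X,
      Pi.add_apply, map_add, add_mul, sum_add_distrib]

theorem pairFun_update {K m : ℕ} (Ψ : V m [⋀^Fin 3]→ₗ[ℂ] ℂ) (r : PairEq K)
    (f : Fin K × Bool → Fin m → ℂ) (a : Fin K × Bool) (z : ℂ) (hz : ‖z‖ = 1) :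
    pairFun Ψ r (Function.update f a (z • f a)) = z ^ pairWeight K r a * pairFun Ψ r f := by
  have hconj : conj z = z⁻¹ := by
    rw [Complex.inv_def, Complex.normSq_eq_norm_sq, hz]; simp
  have hz0 : z ≠ 0 := fun h => by simp [h] at hz
  match r with
  | .inl ⟨i, j⟩ =>
    have hij : (pairEnum K).symm j ≠ (pairEnum K).symm i :=
      (pairEnum K).symm.injective.ne (Finset.mem_Ioi.1 j.2).ne'
    simp only [pairFun, pairWeight, Pi.sub_apply, mul_sum]
    refine sum_congr rfl fun c _ => ?_
    rcases eq_or_ne a ((pairEnum K).symm i) with rfl | hi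
    · simp [Function.update_of_ne hij, hij.symm, hconj]
      ring
    rcases eq_or_ne a ((pairEnum K).symm j) with rfl | hj
    · simp [Function.update_of_ne hi.symm, hij]
      ring
    · simp [Function.update_of_ne hi.symm, Function.update_of_ne hj.symm, hi, hj]
  | .inr ⟨k, none⟩ => simp [pairFun]
  | .inr ⟨k, some j⟩ =>
    have key : ∀ (x : Fin 3 → Fin K × Bool), Function.Injective x →
        Ψ (fun t => WithLp.toLp 2 (Function.update f a (z • f a) (x t))) =
          z ^ (∑ t, (Pi.single (x t) 1 : Fin K × Bool → ℤ) a) *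
            Ψ (fun t => WithLp.toLp 2 (f (x t))) := by
      intro x hx
      by_cases h : ∃ t, x t = a
      · obtain ⟨t, rfl⟩ := h
        have h1 : (fun t' => WithLp.toLp 2 (Function.update f (x t) (z • f (x t)) (x t'))) =
            Function.update (fun t' => WithLp.toLp 2 (f (x t'))) t
              (z • (WithLp.toLp 2 (f (x t)))) := by
          ext t' c
          rcases eq_or_ne t' t with rfl | ht
          · simp
          · simp [Function.update_of_ne ht, Function.update_of_ne (hx.ne ht)]
        rw [h1, Ψ.map_update_smul, Function.update_eq_self, Finset.sum_eq_single t]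
        · simp
        · intro b _ hb
          simp [hx.ne hb.symm]
        · simp
      · push Not at h
        have h0 : ∀ t, (Pi.single (x t) 1 : Fin K × Bool → ℤ) a = 0 := fun t => by
          simp [(h t).symm]
        simp only [h0, sum_const_zero, zpow_zero, one_mul, Function.update_of_ne (h _)]
    have hj := j.2
    have := key ![(k, false), (k, true), j] (by
      intro s t hst
      have h1 : (k, false) ≠ j.1 := fun h => hj (by rw [← h])
      have h2 : (k, true) ≠ j.1 := fun h => hj (by rw [← h])
      fin_cases s <;> fin_cases t <;> simp_all [eq_comm])
    simp only [Fin.sum_univ_three] at this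
    simp only [pairFun, pairWeight, Pi.add_apply]
    exact this

theorem contDiff_pairFun {K m : ℕ} (Ψ : V m [⋀^Fin 3]→ₗ[ℂ] ℂ) (r : PairEq K) :
    ContDiff ℝ ∞ (pairFun Ψ r) := by
  have happ : ∀ a : Fin K × Bool, ContDiff ℝ ∞ fun f : Fin K × Bool → Fin m → ℂ => f a :=
    fun a => contDiff_apply ℝ _ a
  match r with
  | .inl ⟨i, j⟩ =>
    refine ContDiff.sum fun c _ => ContDiff.mul ?_ (contDiff_pi.1 (happ _) c)
    exact Complex.conjCLE.contDiff.comp (contDiff_pi.1 (happ _) c)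
  | .inr ⟨k, none⟩ => exact contDiff_const
  | .inr ⟨k, some j⟩ =>
    exact contDiff_alternating_three Ψ _ fun t => happ _

/-- Every alternating trilinear form admits an orthonormal basis divided into pairs such that the
form vanishes on every triple containing a pair. -/
theorem exists_orthonormal_pairs (K : ℕ) (hK : 3 ≤ K) (Ψ : V (2 * K) [⋀^Fin 3]→ₗ[ℂ] ℂ) :
    ∃ b : Fin K × Bool → V (2 * K), Orthonormal ℂ b ∧
      ∀ k j, Ψ ![b (k, false), b (k, true), b j] = 0 := by
  obtain ⟨n, hn⟩ : ∃ n, 2 * K = n + 1 := ⟨2 * K - 1, by omega⟩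
  have hn' : n = 2 * K - 1 := by omega
  obtain ⟨f, hf0, hf⟩ : ∃ f : Fin K × Bool → Fin (2 * K) → ℂ,
      (∀ i, f i ≠ 0) ∧ ∀ r, pairFun Ψ r f = 0 := by
    have main : ∀ (m : ℕ) (_ : m = n + 1) (Ψ : V m [⋀^Fin 3]→ₗ[ℂ] ℂ),
        ∃ f : Fin K × Bool → Fin m → ℂ,
        (∀ i, f i ≠ 0) ∧ ∀ r, pairFun Ψ r f = 0 := by
      rintro m rfl Ψ
      refine exists_common_zero ?_ (pairWeight K) (pairFun Ψ) (contDiff_pairFun Ψ)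
        (pairFun_update Ψ) ?_
      · rw [card_pairEq, hn']
        simp [mul_comm K]
      · rw [prod_pairWeight, hn']
        exact coeff_vandermonde_mul_pairs_ne_zero K hK
    exact main _ hn Ψ
  have hb0 : ∀ i, (WithLp.toLp 2 (f i) : V (2 * K)) ≠ 0 := fun i h =>
    hf0 i (by simpa using congrArg WithLp.ofLp h)
  have hlt : ∀ i j, pairEnum K i < pairEnum K j →
      inner ℂ (WithLp.toLp 2 (f i) : V (2 * K)) (WithLp.toLp 2 (f j)) = 0 := by
    intro i j hij
    have := hf (.inl ⟨pairEnum K i, pairEnum K j, Finset.mem_Ioi.2 hij⟩)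
    simp only [pairFun, Equiv.symm_apply_apply] at this
    rw [PiLp.inner_apply, ← this]
    exact sum_congr rfl fun c _ => by simp [mul_comm]
  refine ⟨fun i => ((‖(WithLp.toLp 2 (f i) : V (2 * K))‖ : ℂ)⁻¹) • WithLp.toLp 2 (f i), ⟨?_, ?_⟩, ?_⟩
  · intro i
    rw [norm_smul, norm_inv, Complex.norm_real, norm_norm]
    exact inv_mul_cancel₀ (norm_ne_zero_iff.2 (hb0 i))
  · intro i j hij
    rw [inner_smul_left, inner_smul_right]
    rcases lt_or_gt_of_ne ((pairEnum K).injective.ne hij) with h | h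
    · rw [hlt i j h]; simp
    · rw [inner_eq_zero_symm.1 (hlt j i h)]; simp
  · intro k j
    have key : Ψ ![WithLp.toLp 2 (f (k, false)), WithLp.toLp 2 (f (k, true)),
        WithLp.toLp 2 (f j)] = 0 := by
      by_cases hj : j.1 = k
      · obtain ⟨j, c⟩ := j
        subst hj
        cases c
        · exact alternating_three_self_outer Ψ _ _
        · exact alternating_three_self_right Ψ _ _
      · have := hf (.inr ⟨k, some ⟨j, hj⟩⟩)
        simp only [pairFun] at this
        rw [← this]
        congr 1
        ext t : 1
        fin_cases t <;> rfl
    have h := Ψ.map_smul_univ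
      (fun t => ![((‖(WithLp.toLp 2 (f (k, false)) : V (2 * K))‖ : ℂ)⁻¹),
        ((‖(WithLp.toLp 2 (f (k, true)) : V (2 * K))‖ : ℂ)⁻¹),
        ((‖(WithLp.toLp 2 (f j) : V (2 * K))‖ : ℂ)⁻¹)] t)
      ![WithLp.toLp 2 (f (k, false)), WithLp.toLp 2 (f (k, true)), WithLp.toLp 2 (f j)]
    rw [key, smul_zero] at h
    rw [← h]
    congr 1
    ext t : 1
    fin_cases t <;> rfl

end PairBasis

section Rotation

open scoped ComplexConjugate

theorem exists_unit_smul {a b : ℂ} (h : a ≠ 0 ∨ b ≠ 0) :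
    ∃ c : ℂ, (c * a) * conj (c * a) + (c * b) * conj (c * b) = 1 := by
  have hpos : 0 < Complex.normSq a + Complex.normSq b := by
    rcases h with h | h
    · linarith [Complex.normSq_pos.2 h, Complex.normSq_nonneg b]
    · linarith [Complex.normSq_pos.2 h, Complex.normSq_nonneg a]
  refine ⟨((Real.sqrt (Complex.normSq a + Complex.normSq b))⁻¹ : ℝ), ?_⟩
  have h2 : ((Real.sqrt (Complex.normSq a + Complex.normSq b))⁻¹) ^ 2 *
      (Complex.normSq a + Complex.normSq b) = 1 := by
    rw [inv_pow, Real.sq_sqrt hpos.le, inv_mul_cancel₀ hpos.ne']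
  rw [Complex.mul_conj, Complex.mul_conj, map_mul, map_mul, Complex.normSq_ofReal,
    ← Complex.ofReal_add, ← Complex.ofReal_one, Complex.ofReal_inj, ← h2]
  ring

theorem exists_unit_kernel {x y x' y' : ℂ} (h : x * y' = y * x') :
    ∃ a b : ℂ, a * conj a + b * conj b = 1 ∧ a * x + b * y = 0 ∧ a * x' + b * y' = 0 := by
  by_cases h1 : x ≠ 0 ∨ y ≠ 0
  · obtain ⟨c, hc⟩ := exists_unit_smul (a := y) (b := -x) (by simpa [or_comm] using h1)
    exact ⟨c * y, c * -x, hc, by ring, by linear_combination -c * h⟩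
  by_cases h2 : x' ≠ 0 ∨ y' ≠ 0
  · obtain ⟨c, hc⟩ := exists_unit_smul (a := y') (b := -x') (by simpa [or_comm] using h2)
    exact ⟨c * y', c * -x', hc, by linear_combination c * h, by ring⟩
  · push Not at h1 h2
    exact ⟨1, 0, by simp, by simp [h1], by simp [h2]⟩

theorem exists_unit_quadratic (A B C : ℂ) :
    ∃ a b : ℂ, a * conj a + b * conj b = 1 ∧ A * a ^ 2 + B * (a * b) + C * b ^ 2 = 0 := by
  by_cases hA : A = 0
  · exact ⟨1, 0, by simp, by simp [hA]⟩
  obtain ⟨s, hs⟩ := IsAlgClosed.exists_pow_nat_eq (discrim A B C) (n := 2) (by norm_num)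
  obtain ⟨x, hx⟩ := exists_quadratic_eq_zero hA ⟨s, by rw [← hs, sq]⟩
  obtain ⟨c, hc⟩ := exists_unit_smul (a := x) (b := 1) (by simp)
  exact ⟨c * x, c * 1, hc, by linear_combination c ^ 2 * hx⟩

variable {E : Type*} [NormedAddCommGroup E] [InnerProductSpace ℂ E]

/-- The image of a pair of vectors under the rotation with first column `a`. -/
def rotatePair (a : ℂ × ℂ) (b : Bool → E) : Bool → E
  | false => a.1 • b false + a.2 • b true
  | true => (-conj a.2) • b false + conj a.1 • b true

theorem orthonormal_rotatePair {K : ℕ} {b : Fin K × Bool → E} (hb : Orthonormal ℂ b)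
    (a : Fin K → ℂ × ℂ)
    (ha : ∀ k, (a k).1 * conj (a k).1 + (a k).2 * conj (a k).2 = 1) :
    Orthonormal ℂ fun i : Fin K × Bool => rotatePair (a i.1) (fun c => b (i.1, c)) i.2 := by
  rw [orthonormal_iff_ite] at hb ⊢
  rintro ⟨i, c⟩ ⟨j, d⟩
  have h := ha i
  rcases eq_or_ne i j with rfl | hij
  · cases c <;> cases d <;>
      simp only [rotatePair, inner_add_left, inner_add_right, inner_smul_left, inner_smul_right,
        hb] <;> simp
    · linear_combination h
    · ring
    · ring
    · linear_combination h
  · cases c <;> cases d <;>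
      simp only [rotatePair, inner_add_left, inner_add_right, inner_smul_left, inner_smul_right,
        hb] <;> simp [hij]

theorem alternating_three_rotatePair (Ψ : E [⋀^Fin 3]→ₗ[ℂ] ℂ) {K : ℕ} {b : Fin K × Bool → E}
    (h : ∀ k j, Ψ ![b (k, false), b (k, true), b j] = 0) (a : Fin K → ℂ × ℂ) (k : Fin K)
    (j : Fin K × Bool) :
    Ψ ![rotatePair (a k) (fun c => b (k, c)) false, rotatePair (a k) (fun c => b (k, c)) true,
      rotatePair (a j.1) (fun c => b (j.1, c)) j.2] = 0 := by
  have h1 : ∀ w, Ψ ![b (k, false), b (k, true), w] = 0 →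
      Ψ ![rotatePair (a k) (fun c => b (k, c)) false, rotatePair (a k) (fun c => b (k, c)) true,
        w] = 0 := by
    intro w hw
    simp only [rotatePair, alternating_three_fst, alternating_three_snd,
      alternating_three_self_left, alternating_three_swap Ψ (b (k, false)) (b (k, true)), hw]
    simp
  refine h1 _ ?_
  obtain ⟨j, c⟩ := j
  cases c <;> simp only [rotatePair, alternating_three_thd, h, mul_zero, add_zero]

end Rotation

section Refinement

open scoped ComplexConjugate

variable {E : Type*} [NormedAddCommGroup E] [InnerProductSpace ℂ E]

theorem exists_rotation_three (Ψ : E [⋀^Fin 3]→ₗ[ℂ] ℂ) (b₀ b₁ b₂ : Bool → E) :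
    ∃ a₀ a₁ a₂ : ℂ × ℂ, (a₀.1 * conj a₀.1 + a₀.2 * conj a₀.2 = 1) ∧
      (a₁.1 * conj a₁.1 + a₁.2 * conj a₁.2 = 1) ∧ (a₂.1 * conj a₂.1 + a₂.2 * conj a₂.2 = 1) ∧
      Ψ ![rotatePair a₀ b₀ false, rotatePair a₁ b₁ false, rotatePair a₂ b₂ false] = 0 ∧
      Ψ ![rotatePair a₀ b₀ false, rotatePair a₁ b₁ false, rotatePair a₂ b₂ true] = 0 ∧
      Ψ ![rotatePair a₀ b₀ false, rotatePair a₁ b₁ true, rotatePair a₂ b₂ true] = 0 := by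
  set T : Bool → Bool → Bool → ℂ := fun i j k => Ψ ![b₀ i, b₁ j, b₂ k] with hT
  obtain ⟨p, q, hpq, hdet⟩ := exists_unit_quadratic
    (T false false false * T false true true - T false false true * T false true false)
    (T false false false * T true true true + T true false false * T false true true -
      T false false true * T true true false - T true false true * T false true false)
    (T true false false * T true true true - T true false true * T true true false)
  set S : Bool → Bool → ℂ := fun j k => p * T false j k + q * T true j k with hS
  have hSdet : S false false * S true true = S true false * S false true := by
    simp only [hS]
    linear_combination hdet
  obtain ⟨r, s, hrs, h1, h2⟩ := exists_unit_kernel hSdet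
  obtain ⟨t, u, htu, h3, h4⟩ := exists_unit_kernel (x := S false false) (y := S false true)
    (x' := S true false) (y' := S true true) (by linear_combination hSdet)
  have key : ∀ x : E, ∀ y : E, Ψ ![rotatePair (p, q) b₀ false, x, y] =
      p * Ψ ![b₀ false, x, y] + q * Ψ ![b₀ true, x, y] := fun x y => by
    simp [rotatePair, alternating_three_fst]
  refine ⟨(p, q), (r, s), (conj u, -conj t), hpq, hrs, ?_, ?_, ?_, ?_⟩
  · simp
    linear_combination htu
  · simp only [key]
    simp only [rotatePair, alternating_three_snd, alternating_three_thd]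
    simp only [hS, hT] at h1 h2
    linear_combination conj u * h1 - conj t * h2
  · simp only [key]
    simp only [rotatePair, alternating_three_snd, alternating_three_thd]
    simp only [hS, hT] at h1 h2
    simp
    linear_combination t * h1 + u * h2
  · simp only [key]
    simp only [rotatePair, alternating_three_snd, alternating_three_thd]
    simp only [hS, hT] at h3 h4
    simp
    linear_combination (-conj s) * h3 + conj r * h4

theorem exists_rotation_step (Ψ : E [⋀^Fin 3]→ₗ[ℂ] ℂ) (x y : E) (b : Bool → E) :
    ∃ a : ℂ × ℂ, a.1 * conj a.1 + a.2 * conj a.2 = 1 ∧ Ψ ![x, y, rotatePair a b false] = 0 := by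
  obtain ⟨r, s, h, h1, -⟩ := exists_unit_kernel (x := Ψ ![x, y, b false])
    (y := Ψ ![x, y, b true]) (x' := 0) (y' := 0) (by simp)
  exact ⟨(r, s), h, by simpa [rotatePair, alternating_three_thd] using h1⟩

/-- The rotations can be chosen such that the remaining distinguished coefficients vanish. -/
theorem exists_rotations (Ψ : E [⋀^Fin 3]→ₗ[ℂ] ℂ) (b : ℕ → Bool → E) :
    ∃ a : ℕ → ℂ × ℂ, (∀ k, (a k).1 * conj (a k).1 + (a k).2 * conj (a k).2 = 1) ∧
      Ψ ![rotatePair (a 0) (b 0) false, rotatePair (a 1) (b 1) false,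
        rotatePair (a 2) (b 2) true] = 0 ∧
      Ψ ![rotatePair (a 0) (b 0) false, rotatePair (a 1) (b 1) true,
        rotatePair (a 2) (b 2) true] = 0 ∧
      ∀ k, 1 ≤ k → Ψ ![rotatePair (a 0) (b 0) false, rotatePair (a k) (b k) false,
        rotatePair (a (k + 1)) (b (k + 1)) false] = 0 := by
  obtain ⟨a₀, a₁, a₂, h0, h1, h2, h3, h4, h5⟩ := exists_rotation_three Ψ (b 0) (b 1) (b 2)
  choose g hg1 hg2 using fun (k : ℕ) (a : ℂ × ℂ) =>
    exists_rotation_step Ψ (rotatePair a₀ (b 0) false) (rotatePair a (b k) false) (b (k + 1))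
  let c : ℕ → ℂ × ℂ := fun n => Nat.rec a₂ (fun k a => g (k + 2) a) n
  let a : ℕ → ℂ × ℂ := fun n => match n with
    | 0 => a₀
    | 1 => a₁
    | n + 2 => c n
  refine ⟨a, ?_, h4, h5, ?_⟩
  · rintro (_ | _ | _ | n)
    exacts [h0, h1, h2, hg1 _ _]
  · rintro (_ | _ | n) hk
    exacts [absurd hk (by norm_num), h3, hg2 _ _]

end Refinement

section Normalize

open scoped ComplexConjugate

/-- An orthonormal basis in which the coefficients of an alternating trilinear form vanish on all
triples containing a pair and on the distinguished triples. -/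
theorem exists_orthonormal_normal_form (K : ℕ) (hK : 3 ≤ K)
    (Ψ : V (2 * K) [⋀^Fin 3]→ₗ[ℂ] ℂ) :
    ∃ b : ℕ → V (2 * K), Orthonormal ℂ (fun i : Fin (2 * K) => b i) ∧
      (∀ k j, k < K → j < 2 * K → Ψ ![b (2 * k), b (2 * k + 1), b j] = 0) ∧
      Ψ ![b 0, b 2, b 5] = 0 ∧ Ψ ![b 0, b 3, b 5] = 0 ∧
      ∀ k, 1 ≤ k → Ψ ![b 0, b (2 * k), b (2 * k + 2)] = 0 := by
  obtain ⟨v, hv, hvΨ⟩ := exists_orthonormal_pairs K hK Ψ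
  let w : ℕ → Bool → V (2 * K) := fun k c => if h : k < K then v (⟨k, h⟩, c) else 0
  obtain ⟨a, ha, h1, h2, h3⟩ := exists_rotations Ψ w
  have hw : ∀ k : Fin K, w k = fun c => v (k, c) := fun k => by
    ext1 c
    simp [w]
  let b : ℕ → V (2 * K) := fun i => rotatePair (a (i / 2)) (w (i / 2)) (i % 2 == 1)
  have hb0 : ∀ k, b (2 * k) = rotatePair (a k) (w k) false := fun k => by
    simp [b]
  have hb1 : ∀ k, b (2 * k + 1) = rotatePair (a k) (w k) true := fun k => by
    have : (2 * k + 1) / 2 = k := by omega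
    simp [b, this]
  refine ⟨b, ?_, ?_, ?_, ?_, ?_⟩
  · have h := (orthonormal_rotatePair hv (fun k => a k) fun k => ha k).comp
      (fun i : Fin (2 * K) => ((⟨i / 2, by omega⟩ : Fin K), ((i : ℕ) % 2 == 1))) (by
        intro i j hij
        simp only [Prod.mk.injEq, Fin.mk.injEq] at hij
        obtain ⟨h1, h2⟩ := hij
        ext
        rcases Nat.mod_two_eq_zero_or_one i with h | h <;>
          rcases Nat.mod_two_eq_zero_or_one j with h' | h' <;> simp [h, h'] at h2 <;> omega)
    refine (congrArg (Orthonormal ℂ) (funext fun i => ?_)).mp h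
    simp only [b, Function.comp]
    rw [← hw ⟨i / 2, by omega⟩]
  · intro k j hk hj
    have h := alternating_three_rotatePair Ψ hvΨ (fun k => a k) ⟨k, hk⟩
      (⟨j / 2, by omega⟩, j % 2 == 1)
    rw [hb0, hb1]
    rw [← hw, ← hw] at h
    exact h
  · exact h1
  · exact h2
  · intro k hk
    have := h3 k hk
    rw [← hb0, ← hb0, ← hb0] at this
    exact this

end Normalize

section Coefficients

open scoped ComplexConjugate

/-- The alternating form whose values on an orthonormal basis are the conjugate coefficients of
the trivector `v 0 ∧ v 1 ∧ v 2`. -/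
def trivectorForm {M : ℕ} (v : Fin 3 → V M) : V M [⋀^Fin 3]→ₗ[ℂ] ℂ :=
  Matrix.detRowAlternating.compLinearMap
    (LinearMap.pi fun j => (innerₛₗ ℂ (v j)) : V M →ₗ[ℂ] Fin 3 → ℂ)

theorem trivectorForm_apply {M : ℕ} (v x : Fin 3 → V M) :
    trivectorForm v x = (Matrix.of fun i j => inner ℂ (v j) (x i)).det := rfl

theorem luMap_ιMulti {M : ℕ} (b : OrthonormalBasis (Fin M) ℂ (V M)) (v : Fin 3 → V M) :
    luMap M b.repr (ExteriorAlgebra.ιMulti ℂ 3 v) =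
      ∑ s : Fin 3 → Fin M, (∏ j, inner ℂ (b (s j)) (v j)) •
        ExteriorAlgebra.ιMulti ℂ 3 fun j => (EuclideanSpace.single (s j) 1 : V M) := by
  have h1 : luMap M b.repr (ExteriorAlgebra.ιMulti ℂ 3 v) =
      ExteriorAlgebra.ιMulti ℂ 3 fun j => ∑ i, inner ℂ (b i) (v j) •
        (EuclideanSpace.single i 1 : V M) := by
    rw [luMap, ExteriorAlgebra.map_apply_ιMulti]
    congr 1
    ext j i
    simp [Pi.single_apply, OrthonormalBasis.repr_apply_apply]
  rw [h1]
  have h2 := (ExteriorAlgebra.ιMulti ℂ (M := V M) 3).toMultilinearMap.map_sum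
    (g := fun j i => inner ℂ (b i) (v j) • (EuclideanSpace.single i 1 : V M))
  simp only [MultilinearMap.map_smul_univ] at h2
  exact h2

theorem six_smul_luMap_ιMulti {M : ℕ} (b : OrthonormalBasis (Fin M) ℂ (V M)) (v : Fin 3 → V M) :
    (6 : ℂ) • luMap M b.repr (ExteriorAlgebra.ιMulti ℂ 3 v) =
      ∑ s : Fin 3 → Fin M, conj (trivectorForm v fun j => b (s j)) •
        ExteriorAlgebra.ιMulti ℂ 3 fun j => (EuclideanSpace.single (s j) 1 : V M) := by
  have h : ∀ σ : Equiv.Perm (Fin 3), luMap M b.repr (ExteriorAlgebra.ιMulti ℂ 3 v) =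
      ∑ s : Fin 3 → Fin M, ((Equiv.Perm.sign σ : ℤ) • ∏ j, inner ℂ (b (s (σ j))) (v j)) •
        ExteriorAlgebra.ιMulti ℂ 3 fun j => (EuclideanSpace.single (s j) 1 : V M) := by
    intro σ
    rw [luMap_ιMulti, ← (Equiv.arrowCongr σ.symm (Equiv.refl (Fin M))).sum_comp]
    refine sum_congr rfl fun s _ => ?_
    have h1 := (ExteriorAlgebra.ιMulti ℂ (M := V M) 3).map_perm
      (fun j => (EuclideanSpace.single (s j) 1 : V M)) σ
    have h2 : (fun j => (EuclideanSpace.single (Equiv.arrowCongr σ.symm (Equiv.refl (Fin M)) s j) 1 :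
        V M)) = (fun j => (EuclideanSpace.single (s j) 1 : V M)) ∘ σ := rfl
    rw [h2, h1]
    simp only [Equiv.arrowCongr_apply, Function.comp, Equiv.refl_apply, Equiv.symm_symm]
    rcases Int.units_eq_one_or (Equiv.Perm.sign σ) with hσ | hσ <;> simp [hσ]
  have hsum := Finset.sum_congr rfl fun σ (_ : σ ∈ (univ : Finset (Equiv.Perm (Fin 3)))) => h σ
  rw [sum_const, card_univ, Fintype.card_perm, Fintype.card_fin, sum_comm] at hsum
  have h6 : (6 : ℂ) • luMap M b.repr (ExteriorAlgebra.ιMulti ℂ 3 v) =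
      (Nat.factorial 3) • luMap M b.repr (ExteriorAlgebra.ιMulti ℂ 3 v) := by
    rw [← Nat.cast_smul_eq_nsmul ℂ]
    norm_num [Nat.factorial]
  rw [h6, hsum]
  refine sum_congr rfl fun s _ => ?_
  rw [← sum_smul, trivectorForm_apply, Matrix.det_apply, map_sum]
  congr 1
  refine sum_congr rfl fun σ _ => ?_
  rcases Int.units_eq_one_or (Equiv.Perm.sign σ) with hσ | hσ <;> simp [hσ, map_prod]

theorem exists_form {M : ℕ} {ψ : ExteriorAlgebra ℂ (V M)} (hψ : ψ ∈ ⋀[ℂ]^3 (V M)) :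
    ∃ Ψ : V M [⋀^Fin 3]→ₗ[ℂ] ℂ, ∀ b : OrthonormalBasis (Fin M) ℂ (V M),
      (6 : ℂ) • luMap M b.repr ψ = ∑ s : Fin 3 → Fin M, conj (Ψ fun j => b (s j)) •
        ExteriorAlgebra.ιMulti ℂ 3 fun j => (EuclideanSpace.single (s j) 1 : V M) := by
  rw [← ExteriorAlgebra.ιMulti_span_fixedDegree] at hψ
  induction hψ using Submodule.span_induction with
  | mem x hx =>
    obtain ⟨v, rfl⟩ := hx
    exact ⟨trivectorForm v, fun b => six_smul_luMap_ιMulti b v⟩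
  | zero => exact ⟨0, fun b => by simp⟩
  | add x y _ _ hx hy =>
    obtain ⟨Ψ, hΨ⟩ := hx
    obtain ⟨Ψ', hΨ'⟩ := hy
    exact ⟨Ψ + Ψ', fun b => by simp [hΨ, hΨ', add_smul, sum_add_distrib]⟩
  | smul c x _ hx =>
    obtain ⟨Ψ, hΨ⟩ := hx
    refine ⟨conj c • Ψ, fun b => ?_⟩
    rw [map_smul, smul_comm, hΨ, smul_sum]
    simp [mul_smul]

theorem luMap_mem_of_forall {M : ℕ} {ψ : ExteriorAlgebra ℂ (V M)} {Ψ : V M [⋀^Fin 3]→ₗ[ℂ] ℂ}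
    {b : OrthonormalBasis (Fin M) ℂ (V M)}
    (h : (6 : ℂ) • luMap M b.repr ψ = ∑ s : Fin 3 → Fin M, conj (Ψ fun j => b (s j)) •
        ExteriorAlgebra.ιMulti ℂ 3 fun j => (EuclideanSpace.single (s j) 1 : V M))
    (W : Submodule ℂ (ExteriorAlgebra ℂ (V M)))
    (hW : ∀ s : Fin 3 → Fin M, StrictMono s → Ψ (fun j => b (s j)) ≠ 0 →
      ExteriorAlgebra.ιMulti ℂ 3 (fun j => (EuclideanSpace.single (s j) 1 : V M)) ∈ W) :
    luMap M b.repr ψ ∈ W := by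
  rw [← W.smul_mem_iff (by norm_num : (6 : ℂ) ≠ 0), h]
  refine W.sum_mem fun s _ => ?_
  by_cases hs : Ψ (fun j => b (s j)) = 0
  · simp [hs]
  have hinj : Function.Injective s := fun i j hij => by
    by_contra hne
    exact hs (Ψ.map_eq_zero_of_eq _ (congrArg b hij) hne)
  refine W.smul_mem _ ?_
  have hmono : StrictMono (s ∘ Tuple.sort s) :=
    (Tuple.monotone_sort s).strictMono_of_injective (hinj.comp (Tuple.sort s).injective)
  have h1 := Ψ.map_perm (fun j => b (s j)) (Tuple.sort s)
  have h2 := (ExteriorAlgebra.ιMulti ℂ (M := V M) 3).map_perm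
      (fun j => (EuclideanSpace.single (s j) 1 : V M)) (Tuple.sort s)
  have h3 := hW _ hmono (by
    refine ne_of_eq_of_ne h1 ?_
    rcases Int.units_eq_one_or (Equiv.Perm.sign (Tuple.sort s)) with hσ | hσ <;> simpa [hσ] using hs)
  have h4 : ExteriorAlgebra.ιMulti ℂ 3 (fun j => (EuclideanSpace.single ((s ∘ Tuple.sort s) j) 1 :
      V M)) = Equiv.Perm.sign (Tuple.sort s) •
        ExteriorAlgebra.ιMulti ℂ 3 (fun j => (EuclideanSpace.single (s j) 1 : V M)) := h2
  rw [h4] at h3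
  rcases Int.units_eq_one_or (Equiv.Perm.sign (Tuple.sort s)) with hσ | hσ <;>
    simpa [hσ] using h3

end Coefficients

section Dimension

theorem stdVec_succ {M : ℕ} (i : Fin M) : stdVec M (i + 1) = EuclideanSpace.single i 1 := by
  rw [stdVec, dif_pos (by omega)]
  rfl

theorem wedge_succ {M N : ℕ} (s : Fin N → Fin M) :
    wedge M N (fun j => s j + 1) =
      ExteriorAlgebra.ιMulti ℂ N fun j => (EuclideanSpace.single (s j) 1 : V M) := by
  simp only [wedge, stdVec_succ]

theorem linearIndependent_wedge (M N : ℕ) :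
    LinearIndependent ℂ fun i : {i : Fin N → ℕ // IsBasisIndex M N i} => wedge M N i := by
  have h1 := (exteriorPower.ιMulti_family_linearIndependent_ofBasis ℂ N
    (EuclideanSpace.basisFun (Fin M) ℂ).toBasis).map' (⋀[ℂ]^N (V M)).subtype
      (Submodule.ker_subtype _)
  let e : {i : Fin N → ℕ // IsBasisIndex M N i} → (Fin N ↪o Fin M) := fun i =>
    OrderEmbedding.ofStrictMono (fun j => ⟨i.1 j - 1, by have := i.2.2 j; omega⟩) fun j k hjk => by
      have h1 := i.2.1 hjk
      have h2 := i.2.2 j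
      simp only [Fin.mk_lt_mk]
      omega
  have he : ∀ i j, ((e i j : Fin M) : ℕ) + 1 = i.1 j := fun i j => by
    have := i.2.2 j
    change i.1 j - 1 + 1 = i.1 j
    omega
  have he_inj : Function.Injective e := fun i i' h => by
    ext j
    rw [← he, ← he, h]
  have h2 := h1.comp (fun i => Set.powersetCard.ofFinEmbEquiv (e i))
    (Set.powersetCard.ofFinEmbEquiv.injective.comp he_inj)
  suffices hfun : (fun i : {i : Fin N → ℕ // IsBasisIndex M N i} => wedge M N i) =
      ((⋀[ℂ]^N (V M)).subtype ∘ exteriorPower.ιMulti_family ℂ N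
        (EuclideanSpace.basisFun (Fin M) ℂ).toBasis) ∘
          fun i => Set.powersetCard.ofFinEmbEquiv (e i) by
    rw [hfun]
    exact h2
  ext1 i
  have hi : i.1 = fun j => ((e i j : Fin M) : ℕ) + 1 := funext fun j => (he i j).symm
  rw [hi, wedge_succ]
  simp [exteriorPower.ιMulti_family, Function.comp_def]

/-- The index triples of the basic single occupancy vectors, for `M = 2 * K`. -/
def sovTriples (K : ℕ) : Finset (ℕ × ℕ × ℕ) :=
  (Icc 1 (2 * K) ×ˢ Icc 1 (2 * K) ×ˢ Icc 1 (2 * K)).filter fun t =>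
    (t.1 + 1) / 2 < (t.2.1 + 1) / 2 ∧ (t.2.1 + 1) / 2 < (t.2.2 + 1) / 2

theorem mem_sovTriples {K : ℕ} (i : Fin 3 → ℕ) :
    (i 0, i 1, i 2) ∈ sovTriples K ↔ IsBasisIndex (2 * K) 3 i ∧ SingleOcc 3 i := by
  simp only [sovTriples, mem_filter, mem_product, mem_Icc, IsBasisIndex, SingleOcc,
    Fin.forall_fin_succ, Fin.strictMono_iff_lt_succ]
  simp
  omega

theorem six_mul_sum_triples (K : ℕ) :
    (6 : ℤ) * ((∑ z ∈ range K, ∑ y ∈ range z, y : ℕ) : ℤ) = K * (K - 1) * (K - 2) := by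
  have h : ∀ z : ℕ, (2 : ℤ) * ((∑ y ∈ range z, y : ℕ) : ℤ) = z * (z - 1) := by
    intro z
    induction z with
    | zero => simp
    | succ z ih =>
      rw [sum_range_succ, Nat.cast_add, mul_add, ih]
      push_cast
      ring
  induction K with
  | zero => simp
  | succ K ih =>
    rw [sum_range_succ, Nat.cast_add, mul_add, ih]
    push_cast at h ⊢
    linear_combination 3 * h K

theorem card_sovTriples (K : ℕ) :
    #(sovTriples K) = 8 * ∑ z ∈ range K, ∑ y ∈ range z, y := by
  have h : #(((range K).sigma fun z => (range z).sigma fun y => range y) ×ˢ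
      (range 2 ×ˢ range 2 ×ˢ range 2)) = 8 * ∑ z ∈ range K, ∑ y ∈ range z, y := by
    simp [card_sigma, mul_comm]
  rw [← h]
  refine Finset.card_nbij'
    (fun t => (⟨(t.2.2 - 1) / 2, (t.2.1 - 1) / 2, (t.1 - 1) / 2⟩,
      (t.1 - 1) % 2, (t.2.1 - 1) % 2, (t.2.2 - 1) % 2))
    (fun u => (2 * u.1.2.2 + u.2.1 + 1, 2 * u.1.2.1 + u.2.2.1 + 1, 2 * u.1.1 + u.2.2.2 + 1))
    ?_ ?_ ?_ ?_
  · rintro ⟨a, b, c⟩ ht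
    simp [sovTriples] at ht ⊢
    omega
  · rintro ⟨⟨z, y, x⟩, p, q, r⟩ hu
    simp [sovTriples] at hu ⊢
    omega
  · rintro ⟨a, b, c⟩ ht
    simp [sovTriples] at ht ⊢
    omega
  · rintro ⟨⟨z, y, x⟩, p, q, r⟩ hu
    simp at hu ⊢
    have h1 : (2 * x + p) / 2 = x := by omega
    have h2 : (2 * y + q) / 2 = y := by omega
    have h3 : (2 * z + r) / 2 = z := by omega
    simp only [h1, h2, h3, true_and]
    omega

/-- The omitted index triples. -/
def omittedTriples (K : ℕ) : Finset (ℕ × ℕ × ℕ) :=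
  insert (1, 3, 6) (insert (1, 4, 6) ((Icc 3 K).image fun i => (1, 2 * i - 3, 2 * i - 1)))

theorem card_omittedTriples {K : ℕ} (hK : 3 ≤ K) : #(omittedTriples K) = K := by
  rw [omittedTriples, card_insert_of_notMem, card_insert_of_notMem, card_image_of_injOn]
  · simp
    omega
  · intro i hi j hj hij
    simp at hi hj hij
    omega
  · simp
    omega
  · simp
    omega

theorem omittedTriples_subset {K : ℕ} (hK : 3 ≤ K) : omittedTriples K ⊆ sovTriples K := by
  intro t ht
  simp only [omittedTriples, mem_insert, mem_image, mem_Icc] at ht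
  rcases ht with rfl | rfl | ⟨i, hi, rfl⟩ <;> simp [sovTriples] <;> omega

theorem finrank_span_wedge {K : ℕ} (T : Finset (ℕ × ℕ × ℕ)) (hT : T ⊆ sovTriples K) :
    Module.finrank ℂ (Submodule.span ℂ {x | ∃ i : Fin 3 → ℕ, (i 0, i 1, i 2) ∈ T ∧
      x = wedge (2 * K) 3 i}) = #T := by
  have hmem : ∀ t : T, IsBasisIndex (2 * K) 3 ![t.1.1, t.1.2.1, t.1.2.2] := fun t =>
    ((mem_sovTriples ![t.1.1, t.1.2.1, t.1.2.2]).1 (hT t.2)).1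
  have hli := (linearIndependent_wedge (2 * K) 3).comp
    (fun t : T => ⟨![t.1.1, t.1.2.1, t.1.2.2], hmem t⟩) (by
      intro t t' h
      have h' := congrArg Subtype.val h
      ext
      · exact congrFun h' 0
      · exact congrFun h' 1
      · exact congrFun h' 2)
  have hrange : {x | ∃ i : Fin 3 → ℕ, (i 0, i 1, i 2) ∈ T ∧ x = wedge (2 * K) 3 i} =
      Set.range fun t : T => wedge (2 * K) 3 ![t.1.1, t.1.2.1, t.1.2.2] := by
    ext x
    constructor
    · rintro ⟨i, hi, rfl⟩
      refine ⟨⟨_, hi⟩, congrArg _ ?_⟩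
      ext j
      fin_cases j <;> rfl
    · rintro ⟨t, rfl⟩
      exact ⟨_, t.2, rfl⟩
  rw [hrange]
  exact (finrank_span_eq_card hli).trans (Fintype.card_coe T)

theorem card_sovTriples_sdiff {K : ℕ} (hK : 3 ≤ K) :
    #(sovTriples K \ omittedTriples K) = 2 * K * (2 * K - 1) * (2 * K - 5) / 6 := by
  rw [card_sdiff_of_subset (omittedTriples_subset hK), card_omittedTriples hK]
  have hle := card_le_card (omittedTriples_subset hK)
  rw [card_omittedTriples hK] at hle
  symm
  apply Nat.div_eq_of_eq_mul_left (by norm_num)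
  have h := six_mul_sum_triples K
  have hc := card_sovTriples K
  obtain ⟨n, rfl⟩ : ∃ n, K = n + 3 := ⟨K - 3, by omega⟩
  have h1 : 2 * (n + 3) - 1 = 2 * n + 5 := by omega
  have h2 : 2 * (n + 3) - 5 = 2 * n + 1 := by omega
  rw [h1, h2]
  zify [hle]
  rw [hc]
  push_cast at h ⊢
  linear_combination -8 * h

end Dimension

section Universality

theorem exists_luMap_mem {K : ℕ} (hK : 3 ≤ K) {ψ : ExteriorAlgebra ℂ (V (2 * K))}
    (hψ : ψ ∈ ⋀[ℂ]^3 (V (2 * K))) (W : Submodule ℂ (ExteriorAlgebra ℂ (V (2 * K))))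
    (hW : ∀ i : Fin 3 → ℕ, (i 0, i 1, i 2) ∈ sovTriples K \ omittedTriples K →
      wedge (2 * K) 3 i ∈ W) :
    ∃ U : V (2 * K) ≃ₗᵢ[ℂ] V (2 * K), luMap (2 * K) U ψ ∈ W := by
  obtain ⟨Ψ, hΨ⟩ := exists_form hψ
  obtain ⟨b, hb, hpair, h025, h035, hstep⟩ := exists_orthonormal_normal_form K hK Ψ
  obtain ⟨B, hB⟩ := Orthonormal.exists_orthonormalBasis_extension_of_card_eq (𝕜 := ℂ)
    (v := fun i : Fin (2 * K) => b i) (s := Set.univ) (by simp)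
    (hb.comp _ Subtype.val_injective)
  refine ⟨B.repr, luMap_mem_of_forall (hΨ B) W fun s hs hne => ?_⟩
  rw [← wedge_succ]
  apply hW
  have hΨs : Ψ (fun j => B (s j)) = Ψ ![b (s 0), b (s 1), b (s 2)] := by
    congr 1
    ext1 j
    fin_cases j <;> exact hB _ trivial
  rw [hΨs] at hne
  have h01 : (s 0 : ℕ) < s 1 := hs (by decide)
  have h12 : (s 1 : ℕ) < s 2 := hs (by decide)
  have hlt := (s 2).2
  generalize (s 0 : ℕ) = x at *
  generalize (s 1 : ℕ) = y at *
  generalize (s 2 : ℕ) = z at *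
  have hxy : x / 2 ≠ y / 2 := fun h => hne <| by
    have := hpair (x / 2) z (by omega) hlt
    rwa [show 2 * (x / 2) = x by omega, show x + 1 = y by omega] at this
  have hyz : y / 2 ≠ z / 2 := fun h => hne <| by
    have := hpair (y / 2) x (by omega) (by omega)
    rwa [show 2 * (y / 2) = y by omega, show y + 1 = z by omega,
      ← alternating_three_rotate] at this
  simp only [mem_sdiff, sovTriples, omittedTriples, mem_filter, mem_product, mem_Icc, mem_insert,
    mem_image, not_or, not_exists, Prod.mk.injEq]
  refine ⟨by omega, ?_, ?_, ?_⟩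
  · rintro ⟨h1, h2, h3⟩
    obtain rfl : x = 0 := by omega
    obtain rfl : y = 2 := by omega
    obtain rfl : z = 5 := by omega
    exact hne h025
  · rintro ⟨h1, h2, h3⟩
    obtain rfl : x = 0 := by omega
    obtain rfl : y = 3 := by omega
    obtain rfl : z = 5 := by omega
    exact hne h035
  · rintro i ⟨hi, h1, h2, h3⟩
    obtain rfl : x = 0 := by omega
    obtain rfl : y = 2 * (i - 2) := by omega
    obtain rfl : z = 2 * (i - 2) + 2 := by omega
    exact hne (hstep _ (by omega))

end Universality

/-- For even `M = 2K ≥ 6`, the subspace spanned by all BSOVs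
`e_{ijk}` except the `K` of them with index triples `(1,3,6)`, `(1,4,6)` and
`(1, 2i-3, 2i-1)` for `3 ≤ i ≤ K` is universal and has dimension
`M(M-1)(M-5)/6`. -/
theorem minimal_universal_subspace_even (K : ℕ) (hK : 3 ≤ K) (M : ℕ) (hM : M = 2 * K)
    (E : Set (ℕ × ℕ × ℕ))
    (hE : E = {t | t = (1, 3, 6) ∨ t = (1, 4, 6) ∨
      ∃ i : ℕ, 3 ≤ i ∧ i ≤ K ∧ t = (1, 2 * i - 3, 2 * i - 1)})
    (W : Submodule ℂ (ExteriorAlgebra ℂ (V M)))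
    (hW : W = Submodule.span ℂ
      {x | ∃ i : Fin 3 → ℕ, IsBasisIndex M 3 i ∧ SingleOcc 3 i ∧
        (i 0, i 1, i 2) ∉ E ∧ x = wedge M 3 i}) :
    (∀ ψ ∈ ⋀[ℂ]^3 (V M), ∃ U : V M ≃ₗᵢ[ℂ] V M, luMap M U ψ ∈ W) ∧
      Module.finrank ℂ W = M * (M - 1) * (M - 5) / 6 := by
  subst hM
  have hE' : ∀ t, t ∈ E ↔ t ∈ omittedTriples K := by
    intro t
    rw [hE]
    simp [omittedTriples, eq_comm, and_assoc]
  have hset : {x | ∃ i : Fin 3 → ℕ, IsBasisIndex (2 * K) 3 i ∧ SingleOcc 3 i ∧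
      (i 0, i 1, i 2) ∉ E ∧ x = wedge (2 * K) 3 i} =
      {x | ∃ i : Fin 3 → ℕ, (i 0, i 1, i 2) ∈ sovTriples K \ omittedTriples K ∧
        x = wedge (2 * K) 3 i} := by
    simp only [mem_sdiff, mem_sovTriples, hE', and_assoc]
  rw [hset] at hW
  subst hW
  refine ⟨fun ψ hψ => exists_luMap_mem hK hψ _ fun i hi => Submodule.subset_span ⟨i, hi, rfl⟩, ?_⟩
  rw [finrank_span_wedge _ sdiff_subset, card_sovTriples_sdiff hK]
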